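/- arXiv:1303.4096 — 4 statements merged into one kernel-verified Lean document; each statement's English description precedes it below -/
import Mathlib

section
/- (Sudakov minoration.) There is a universal constant c > 0 with the following property. Let N be a positive integer, let g be a standard Gaussian random vector in ℝ^N, let T be a compact metric space, and let v : T → ℝ^N be a continuous map. Define the centered Gaussian process Y_t = ⟨v(t), g⟩ for t ∈ T, and the canonical pseudometric d(s,t) = ‖v(s) − v(t)‖ (so that d(s,t)² = 𝔼(Y_s − Y_t)²). Then for every ε > 0, 𝔼 sup_{t ∈ T} Y_t ≥ c · ε · √(log N(T, d, ε)). -/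
open MeasureTheory ProbabilityTheory

/-- The covering number `N(T, ρ, ε)`: the minimal cardinality of a finite set `S ⊆ T`
such that every point of `T` is within `ρ`-distance `ε` of some point of `S`
(`⊤` if no finite set covers). -/
noncomputable def coveringNumber {T : Type*} (ρ : T → T → ℝ) (ε : ℝ) : ℕ∞ :=
  ⨅ (S : Finset T) (_ : ∀ x : T, ∃ y ∈ S, ρ x y ≤ ε), (S.card : ℕ∞)

variable {ι : Type*} [Fintype ι]

/-- The standard Gaussian measure on `ι → ℝ`. -/
noncomputable abbrev piStdGaussian (ι : Type*) [Fintype ι] : Measure (ι → ℝ) :=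
  Measure.pi (fun _ : ι => gaussianReal 0 1)

theorem pi_withDensity_ofReal {α : ι → Type*} [∀ i, MeasurableSpace (α i)]
    (μ : ∀ i, Measure (α i)) [∀ i, SigmaFinite (μ i)] (f : ∀ i, α i → ℝ)
    (hf : ∀ i, Integrable (f i) (μ i)) (hf0 : ∀ i x, 0 ≤ f i x) :
    Measure.pi (fun i => (μ i).withDensity fun x => ENNReal.ofReal (f i x)) =
      (Measure.pi μ).withDensity fun x => ENNReal.ofReal (∏ i, f i (x i)) := by
  refine Measure.pi_eq fun s hs => ?_
  have hfs (i : ι) : Integrable (f i) ((μ i).restrict (s i)) := (hf i).restrict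
  rw [withDensity_apply _ (.univ_pi hs), Measure.restrict_pi_pi,
    ← ofReal_integral_eq_lintegral_ofReal (Integrable.fintype_prod_dep hfs)
      (ae_of_all _ fun x => Finset.prod_nonneg fun i _ => hf0 i _),
    integral_fintype_prod_eq_prod, ENNReal.ofReal_prod_of_nonneg
      fun i _ => integral_nonneg fun x => hf0 i x]
  refine Finset.prod_congr rfl fun i _ => ?_
  rw [withDensity_apply _ (hs i),
    ← ofReal_integral_eq_lintegral_ofReal (hfs i) (ae_of_all _ fun x => hf0 i x)]

theorem piStdGaussian_map_add_const (y : ι → ℝ) :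
    (piStdGaussian ι).map (fun x => x + y) =
      volume.withDensity fun x => ENNReal.ofReal (∏ i, gaussianPDFReal (y i) 1 (x i)) := by
  have h : (piStdGaussian ι).map (fun x => x + y) =
      Measure.pi fun i => (gaussianReal 0 1).map (fun a => a + y i) :=
    Measure.pi_map_pi (f := fun i a => a + y i) fun i => by fun_prop
  simp_rw [h, gaussianReal_map_add_const, zero_add, gaussianReal_of_var_ne_zero _ one_ne_zero]
  exact pi_withDensity_ofReal _ _ (fun i => integrable_gaussianPDFReal _ _)
    fun i => gaussianPDFReal_nonneg _ _

theorem piStdGaussian_map_neg :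
    (piStdGaussian ι).map (fun x => -x) = piStdGaussian ι := by
  have h : (piStdGaussian ι).map (fun x => -x) =
      Measure.pi fun _ => (gaussianReal 0 1).map (fun a => -a) :=
    Measure.pi_map_pi (f := fun _ a => -a) fun i => by fun_prop
  simpa only [gaussianReal_map_neg, neg_zero] using h

theorem gaussianPDFReal_eq_exp_mul (y x : ℝ) :
    gaussianPDFReal y 1 x = Real.exp (y * x) * Real.exp (-(y * y) / 2) * gaussianPDFReal 0 1 x := by
  simp only [gaussianPDFReal]
  rw [← Real.exp_add, mul_left_comm, ← Real.exp_add]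
  congr 2
  push_cast
  ring

theorem prod_gaussianPDFReal (y x : ι → ℝ) :
    ∏ i, gaussianPDFReal (y i) 1 (x i) =
      Real.exp (y ⬝ᵥ x) * Real.exp (-(y ⬝ᵥ y) / 2) * ∏ i, gaussianPDFReal 0 1 (x i) := by
  simp_rw [gaussianPDFReal_eq_exp_mul (y _), Finset.prod_mul_distrib, ← Real.exp_sum,
    ← Finset.sum_div, Finset.sum_neg_distrib, dotProduct]

/-- Translating a symmetric set by `y` decreases its Gaussian measure by a factor of at most
`exp (-‖y‖² / 2)`. -/
theorem piStdGaussian_le_translate {K : Set (ι → ℝ)} (hK : MeasurableSet K)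
    (hsymm : ∀ x ∈ K, -x ∈ K) (y : ι → ℝ) :
    Real.exp (-(y ⬝ᵥ y) / 2) * (piStdGaussian ι).real K ≤
      (piStdGaussian ι).real {x | x + y ∈ K} := by
  have hdens (z : ι → ℝ) : piStdGaussian ι {x | x + z ∈ K} =
      ∫⁻ x in K, ENNReal.ofReal (∏ i, gaussianPDFReal (z i) 1 (x i)) := by
    rw [← withDensity_apply _ hK, ← piStdGaussian_map_add_const,
      Measure.map_apply (by fun_prop) hK]
    rfl
  have hneg : piStdGaussian ι {x | x + -y ∈ K} = piStdGaussian ι {x | x + y ∈ K} := by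
    have hm : MeasurableSet {x | x + y ∈ K} := hK.preimage (measurable_id.add_const y)
    conv_rhs => rw [← piStdGaussian_map_neg, Measure.map_apply (by fun_prop) hm]
    congr 1
    ext x
    simp only [Set.mem_ofPred_eq, Set.mem_preimage]
    exact ⟨fun h => by simpa [add_comm] using hsymm _ h,
      fun h => by simpa [add_comm] using hsymm _ h⟩
  have hmeas (z : ι → ℝ) :
      Measurable fun x : ι → ℝ => ENNReal.ofReal (∏ i, gaussianPDFReal (z i) 1 (x i)) :=
    (Finset.measurable_prod _ fun i _ =>
      (measurable_gaussianPDFReal _ _).comp (measurable_pi_apply i)).ennreal_ofReal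
  have key : ENNReal.ofReal (2 * Real.exp (-(y ⬝ᵥ y) / 2)) * piStdGaussian ι K ≤
      2 * piStdGaussian ι {x | x + y ∈ K} := by
    have h0 : piStdGaussian ι K = piStdGaussian ι {x | x + 0 ∈ K} := by simp
    rw [two_mul (piStdGaussian ι _)]
    nth_rw 1 [← hneg]
    rw [h0, hdens, hdens, hdens, ← lintegral_add_left (hmeas _),
      ← lintegral_const_mul _ (hmeas _)]
    refine lintegral_mono fun x => ?_
    have hp : 0 ≤ ∏ i, gaussianPDFReal 0 1 (x i) :=
      Finset.prod_nonneg fun i _ => gaussianPDFReal_nonneg _ _ _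
    rw [prod_gaussianPDFReal y, prod_gaussianPDFReal (-y), ← ENNReal.ofReal_add (by positivity)
      (by positivity), ← ENNReal.ofReal_mul (by positivity)]
    refine ENNReal.ofReal_le_ofReal ?_
    simp only [neg_dotProduct, dotProduct_neg, neg_neg, Pi.zero_apply]
    have hexp : 2 ≤ Real.exp (-(y ⬝ᵥ x)) + Real.exp (y ⬝ᵥ x) := by
      linarith [Real.add_one_le_exp (-(y ⬝ᵥ x)), Real.add_one_le_exp (y ⬝ᵥ x)]
    have := mul_le_mul_of_nonneg_right hexp
      (mul_nonneg (Real.exp_pos (-(y ⬝ᵥ y) / 2)).le hp)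
    linarith
  have := ENNReal.toReal_mono (by finiteness) key
  rw [ENNReal.toReal_mul, ENNReal.toReal_mul, ENNReal.toReal_ofReal (by positivity)] at this
  simp only [ENNReal.toReal_ofNat] at this
  simp only [Measure.real]
  linarith

section SupportFunction

variable {T : Type*}

/-- The support function `x ↦ sup_t ⟨v(t), x⟩` of the image of `v`. -/
noncomputable def supportFn (v : T → ι → ℝ) (x : ι → ℝ) : ℝ :=
  ⨆ t, v t ⬝ᵥ x

variable [TopologicalSpace T] [CompactSpace T] {v : T → ι → ℝ}

theorem dotProduct_le_supportFn (hv : Continuous v) (t : T) (x : ι → ℝ) :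
    v t ⬝ᵥ x ≤ supportFn v x :=
  le_ciSup (f := fun t => v t ⬝ᵥ x)
    (isCompact_range (hv.dotProduct continuous_const)).bddAbove t

theorem continuous_supportFn (hv : Continuous v) : Continuous (supportFn v) := by
  have h := isCompact_univ.continuous_sSup (f := fun x t => v t ⬝ᵥ x) (K := Set.univ)
    ((hv.comp continuous_snd).dotProduct continuous_fst)
  simp only [Set.image_univ] at h
  exact h

theorem integrable_supportFn [Nonempty T] (hv : Continuous v) :
    Integrable (supportFn v) (piStdGaussian ι) := by
  obtain ⟨R, hR⟩ := (isCompact_range hv).isBounded.exists_norm_le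
  have hbound (t : T) (x : ι → ℝ) : |v t ⬝ᵥ x| ≤ ∑ i, R * |x i| := by
    refine (Finset.abs_sum_le_sum_abs _ _).trans (Finset.sum_le_sum fun i _ => ?_)
    rw [abs_mul]
    gcongr
    exact (norm_le_pi_norm (v t) i).trans (hR _ ⟨t, rfl⟩)
  have hint : Integrable (fun x : ι → ℝ => ∑ i, R * |x i|) (piStdGaussian ι) :=
    integrable_finsetSum _ fun i _ => (integrable_comp_eval (μ := fun _ => gaussianReal 0 1)
      (f := fun a : ℝ => |a|) ((memLp_id_gaussianReal 1).integrable le_rfl).abs).const_mul R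
  refine hint.mono' (continuous_supportFn hv).aestronglyMeasurable (ae_of_all _ fun x => ?_)
  rw [Real.norm_eq_abs, abs_le]
  obtain ⟨t⟩ := ‹Nonempty T›
  exact ⟨(abs_le.1 (hbound t x)).1.trans (dotProduct_le_supportFn hv t x),
    ciSup_le fun s => (abs_le.1 (hbound s x)).2⟩

theorem supportFn_add_supportFn_neg_nonneg [Nonempty T] (hv : Continuous v) (x : ι → ℝ) :
    0 ≤ supportFn v x + supportFn v (-x) := by
  obtain ⟨t⟩ := ‹Nonempty T›
  have h₁ := dotProduct_le_supportFn hv t x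
  have h₂ := dotProduct_le_supportFn hv t (-x)
  rw [dotProduct_neg] at h₂
  linarith

theorem integrable_supportFn_neg [Nonempty T] (hv : Continuous v) :
    Integrable (fun x => supportFn v (-x)) (piStdGaussian ι) := by
  have h := integrable_supportFn hv
  rw [← piStdGaussian_map_neg] at h
  exact h.comp_measurable measurable_neg

theorem integral_supportFn_neg (hv : Continuous v) :
    ∫ x, supportFn v (-x) ∂piStdGaussian ι = ∫ x, supportFn v x ∂piStdGaussian ι := by
  conv_rhs => rw [← piStdGaussian_map_neg, integral_map measurable_neg.aemeasurable
    (continuous_supportFn hv).aestronglyMeasurable]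

theorem integral_supportFn_nonneg [Nonempty T] (hv : Continuous v) :
    0 ≤ ∫ x, supportFn v x ∂piStdGaussian ι := by
  have h : 0 ≤ ∫ x, supportFn v x + supportFn v (-x) ∂piStdGaussian ι :=
    integral_nonneg fun x => supportFn_add_supportFn_neg_nonneg hv x
  rw [integral_add (integrable_supportFn hv) (integrable_supportFn_neg hv),
    integral_supportFn_neg hv] at h
  linarith

theorem le_measureReal_width_lt [Nonempty T] (hv : Continuous v) {E : ℝ} (hE0 : 0 < E)
    (hE : ∫ x, supportFn v x ∂piStdGaussian ι ≤ E) :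
    3 / 4 ≤ (piStdGaussian ι).real {x | supportFn v x + supportFn v (-x) < 8 * E} := by
  have hmarkov := mul_meas_ge_le_integral_of_nonneg (μ := piStdGaussian ι)
    (ae_of_all _ (supportFn_add_supportFn_neg_nonneg hv))
    ((integrable_supportFn hv).add (integrable_supportFn_neg hv)) (8 * E)
  rw [integral_add (integrable_supportFn hv) (integrable_supportFn_neg hv),
    integral_supportFn_neg hv] at hmarkov
  have hc := continuous_supportFn hv
  have hm : MeasurableSet {x | 8 * E ≤ supportFn v x + supportFn v (-x)} :=
    measurableSet_le measurable_const (by fun_prop)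
  have hcompl := probReal_compl_eq_one_sub (μ := piStdGaussian ι) hm
  have heq : {x | 8 * E ≤ supportFn v x + supportFn v (-x)}ᶜ =
      {x | supportFn v x + supportFn v (-x) < 8 * E} := by ext; simp
  rw [← heq, hcompl]
  have : (piStdGaussian ι).real {x | 8 * E ≤ supportFn v x + supportFn v (-x)} ≤ 1 / 4 := by
    by_contra! h
    nlinarith
  linarith

/-- A separated subset of a ball of twice the separation radius has cardinality controlled by the
Gaussian width. -/
theorem card_le_exp_of_separated [Nonempty T] (hv : Continuous v) {E : ℝ} (hE0 : 0 < E)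
    (hE : ∫ x, supportFn v x ∂piStdGaussian ι ≤ E) {r : ℝ} (hr : 0 < r) (y : ι → ℝ)
    (S : Finset T) (hball : ∀ s ∈ S, (v s - y) ⬝ᵥ (v s - y) ≤ (2 * r) ^ 2)
    (hsep : ∀ s ∈ S, ∀ t ∈ S, s ≠ t → r ^ 2 ≤ (v s - v t) ⬝ᵥ (v s - v t)) :
    (S.card : ℝ) ≤ Real.exp (1024 * E ^ 2 / r ^ 2) := by
  set K : Set (ι → ℝ) := {x | supportFn v x + supportFn v (-x) < 8 * E} with hKdef
  have hc := continuous_supportFn hv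
  have hK : MeasurableSet K := measurableSet_lt (by fun_prop) measurable_const
  have hsymm : ∀ x ∈ K, -x ∈ K := fun x hx => by
    simpa only [hKdef, Set.mem_ofPred_eq, neg_neg, add_comm] using hx
  have hmeasK : 3 / 4 ≤ (piStdGaussian ι).real K := le_measureReal_width_lt hv hE0 hE
  set l : ℝ := 16 * E / r ^ 2 with hl
  have hl0 : 0 < l := by positivity
  have hlr : l * r ^ 2 = 16 * E := by rw [hl]; field_simp
  let A (s : T) : Set (ι → ℝ) := {x | x + l • (v s - y) ∈ K}
  have hA (s : T) : MeasurableSet (A s) := hK.preimage (measurable_id.add_const _)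
  have hdisj : Set.PairwiseDisjoint (S : Set T) A := by
    intro s hs t ht hst
    refine Set.disjoint_left.2 fun x hxs hxt => ?_
    simp only [A, hKdef, Set.mem_ofPred_eq] at hxs hxt
    set a := x + l • (v s - y) with ha
    set b := x + l • (v t - y) with hb
    have hab : a - b = l • (v s - v t) := by
      rw [ha, hb]; module
    have h₁ := dotProduct_le_supportFn hv s a
    have h₂ := dotProduct_le_supportFn hv s (-b)
    have h₃ := dotProduct_le_supportFn hv t (-a)
    have h₄ := dotProduct_le_supportFn hv t b
    have h₅ : (v s - v t) ⬝ᵥ (a - b) = l * ((v s - v t) ⬝ᵥ (v s - v t)) := by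
      rw [hab, dotProduct_smul, smul_eq_mul]
    have h₆ := mul_le_mul_of_nonneg_left (hsep s hs t ht hst) hl0.le
    rw [sub_dotProduct, dotProduct_sub, dotProduct_sub] at h₅
    rw [dotProduct_neg] at h₂ h₃
    linarith
  have hlower (s : T) (hs : s ∈ S) :
      Real.exp (-(512 * E ^ 2 / r ^ 2)) * (3 / 4) ≤ (piStdGaussian ι).real (A s) := by
    refine le_trans ?_ (piStdGaussian_le_translate hK hsymm (l • (v s - y)))
    gcongr
    rw [dotProduct_smul, smul_dotProduct, smul_eq_mul, smul_eq_mul]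
    have h₁ : l * (l * ((v s - y) ⬝ᵥ (v s - y))) ≤ l * (l * (2 * r) ^ 2) := by
      gcongr
      exact hball s hs
    have h₂ : l * (l * (2 * r) ^ 2) = 1024 * E ^ 2 / r ^ 2 := by
      rw [hl]; field_simp; norm_num
    rw [h₂] at h₁
    have h₃ : 1024 * E ^ 2 / r ^ 2 = 2 * (512 * E ^ 2 / r ^ 2) := by ring
    linarith
  have hsum : S.card * (Real.exp (-(512 * E ^ 2 / r ^ 2)) * (3 / 4)) ≤ 1 := by
    calc S.card * (Real.exp (-(512 * E ^ 2 / r ^ 2)) * (3 / 4))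
        = ∑ _s ∈ S, Real.exp (-(512 * E ^ 2 / r ^ 2)) * (3 / 4) := by simp
      _ ≤ ∑ s ∈ S, (piStdGaussian ι).real (A s) := Finset.sum_le_sum hlower
      _ = (piStdGaussian ι).real (⋃ s ∈ S, A s) :=
          (measureReal_biUnion_finset hdisj fun s _ => hA s).symm
      _ ≤ 1 := measureReal_le_one
  have h₁ : 1024 * E ^ 2 / r ^ 2 = 512 * E ^ 2 / r ^ 2 + 512 * E ^ 2 / r ^ 2 := by ring
  have h₂ : 1 ≤ Real.exp (512 * E ^ 2 / r ^ 2) := Real.one_le_exp (by positivity)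
  rw [h₁, Real.exp_add]
  rw [Real.exp_neg, ← div_eq_inv_mul, mul_div_assoc', div_le_one (by positivity)] at hsum
  rcases le_or_gt S.card 1 with hcard | hcard
  · have : (S.card : ℝ) ≤ 1 := by exact_mod_cast hcard
    nlinarith
  · have : (2 : ℝ) ≤ S.card := by exact_mod_cast hcard
    nlinarith

end SupportFunction

section Nets

variable {T : Type*} {ρ : T → T → ℝ}

theorem exists_local_net (hself : ∀ t, ρ t t = 0) (hsymm : ∀ s t, ρ s t = ρ t s) {r : ℝ}
    (hr : 0 < r) {U : Set T} {m : ℕ}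
    (hpack : ∀ S : Finset T, (∀ s ∈ S, s ∈ U) →
      (∀ s ∈ S, ∀ t ∈ S, s ≠ t → r ≤ ρ s t) → S.card ≤ m) :
    ∃ S : Finset T, (∀ x ∈ U, ∃ y ∈ S, ρ x y ≤ r) ∧ S.card ≤ m := by
  classical
  let C : Set ℕ := {n | ∃ S : Finset T, (∀ s ∈ S, s ∈ U) ∧
    (∀ s ∈ S, ∀ t ∈ S, s ≠ t → r ≤ ρ s t) ∧ S.card = n}
  have hbdd : BddAbove C := ⟨m, by
    rintro _ ⟨S, hU, hsep, rfl⟩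
    exact hpack S hU hsep⟩
  obtain ⟨S, hU, hsep, hcard⟩ := Nat.sSup_mem (s := C) ⟨0, ∅, by simp⟩ hbdd
  refine ⟨S, fun x hx => ?_, hpack S hU hsep⟩
  by_contra! hfar
  have hxS : x ∉ S := fun h => absurd (hfar x h) (by rw [hself]; exact hr.le.not_gt)
  have hmem : (insert x S).card ∈ C := by
    refine ⟨insert x S, ?_, ?_, rfl⟩
    · simpa [hx] using hU
    · intro s hs t ht hst
      rcases Finset.mem_insert.1 hs with rfl | hsS <;> rcases Finset.mem_insert.1 ht with rfl | htS
      · exact absurd rfl hst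
      · exact (hfar t htS).le
      · exact hsymm s t ▸ (hfar s hsS).le
      · exact hsep s hsS t htS hst
  have := le_csSup hbdd hmem
  rw [Finset.card_insert_of_notMem hxS] at this
  omega

/-- Bounds on separated sets at every scale, localized to balls of twice that scale, add up to a
bound on the size of nets. -/
theorem exists_net_card_le_exp [Nonempty T] (hself : ∀ t, ρ t t = 0)
    (hsymm : ∀ s t, ρ s t = ρ t s) {D B : ℝ} (hD : ∀ s t, ρ s t ≤ D) (hB : 0 ≤ B)
    (hpack : ∀ r, 0 < r → ∀ t₀, ∀ S : Finset T, (∀ s ∈ S, ρ s t₀ ≤ 2 * r) →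
      (∀ s ∈ S, ∀ t ∈ S, s ≠ t → r ≤ ρ s t) → (S.card : ℝ) ≤ Real.exp (B / r ^ 2))
    (k : ℕ) {r : ℝ} (hr : 0 < r) (hk : D ≤ 2 ^ k * r) :
    ∃ S : Finset T, (∀ x, ∃ y ∈ S, ρ x y ≤ r) ∧ (S.card : ℝ) ≤ Real.exp (2 * B / r ^ 2) := by
  classical
  induction k generalizing r with
  | zero =>
    obtain ⟨t₀⟩ := ‹Nonempty T›
    refine ⟨{t₀}, fun x => ⟨t₀, by simp, (hD x t₀).trans (by simpa using hk)⟩, ?_⟩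
    simpa using Real.one_le_exp (x := 2 * B / r ^ 2) (by positivity)
  | succ k ih =>
    obtain ⟨S, hS, hcard⟩ := ih (r := 2 * r) (by positivity) (by rw [pow_succ] at hk; linarith)
    have hlocal (t₀ : T) : ∃ S : Finset T, (∀ x ∈ {x | ρ x t₀ ≤ 2 * r}, ∃ y ∈ S, ρ x y ≤ r) ∧
        S.card ≤ ⌊Real.exp (B / r ^ 2)⌋₊ :=
      exists_local_net hself hsymm hr fun S hU hsep =>
        Nat.le_floor (hpack r hr t₀ S hU hsep)
    choose L hL hLcard using hlocal
    refine ⟨S.biUnion L, fun x => ?_, ?_⟩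
    · obtain ⟨t₀, ht₀, hx⟩ := hS x
      obtain ⟨y, hy, hxy⟩ := hL t₀ x hx
      exact ⟨y, Finset.mem_biUnion.2 ⟨t₀, ht₀, hy⟩, hxy⟩
    · have h₁ : ((S.biUnion L).card : ℝ) ≤ S.card * ⌊Real.exp (B / r ^ 2)⌋₊ := by
        exact_mod_cast Finset.card_biUnion_le_card_mul _ _ _ fun t _ => hLcard t
      calc ((S.biUnion L).card : ℝ) ≤ S.card * ⌊Real.exp (B / r ^ 2)⌋₊ := h₁
        _ ≤ Real.exp (2 * B / (2 * r) ^ 2) * Real.exp (B / r ^ 2) := by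
            gcongr
            exact Nat.floor_le (Real.exp_pos _).le
        _ = Real.exp (3 / 2 * (B / r ^ 2)) := by
            rw [← Real.exp_add]
            congr 1
            field_simp
            norm_num
        _ ≤ Real.exp (2 * B / r ^ 2) := by
            have : 0 ≤ B / r ^ 2 := by positivity
            rw [mul_div_assoc]
            gcongr
            norm_num

end Nets

theorem coveringNumber_toNat_le_card {T : Type*} {ρ : T → T → ℝ} {ε : ℝ} (S : Finset T)
    (hS : ∀ x, ∃ y ∈ S, ρ x y ≤ ε) : (coveringNumber ρ ε).toNat ≤ S.card := by
  have h : coveringNumber ρ ε ≤ S.card := iInf₂_le S hS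
  simpa using ENat.toNat_le_toNat h (ENat.natCast_ne_top _)

/-- Sudakov's minoration: there is a universal `c > 0` such that for the centered
Gaussian process `Y_t = ⟨v(t), g⟩` (with `g` standard Gaussian in `ℝ^N`) and the
canonical pseudometric `d(s,t) = ‖v(s) − v(t)‖`, one has
`𝔼 sup_t Y_t ≥ c ε √(log N(T,d,ε))` for every `ε > 0`. -/
theorem sudakov_minoration :
    ∃ c : ℝ, 0 < c ∧
      ∀ (N : ℕ), 0 < N →
        ∀ (T : Type) [MetricSpace T] [CompactSpace T]
          (v : T → (Fin N → ℝ)), Continuous v →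
          ∀ (γ : Measure (Fin N → ℝ)),
            γ = Measure.pi (fun _ : Fin N => gaussianReal 0 1) →
            ∀ (ρ : T → T → ℝ),
              (∀ s t : T, ρ s t = Real.sqrt (∑ i, (v s i - v t i) ^ 2)) →
              ∀ ε : ℝ, 0 < ε →
                c * ε * Real.sqrt (Real.log ((coveringNumber ρ ε).toNat)) ≤
                  ∫ x, (⨆ t : T, ∑ i, v t i * x i) ∂γ := by
  refine ⟨1 / 46, by norm_num, ?_⟩
  rintro N - T _ _ v hv γ rfl ρ hρ ε hε
  have hsq (s t : T) : ρ s t = Real.sqrt ((v s - v t) ⬝ᵥ (v s - v t)) := by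
    rw [hρ]
    simp only [dotProduct, Pi.sub_apply, sq]
  have hnonneg (w : Fin N → ℝ) : 0 ≤ w ⬝ᵥ w :=
    Finset.sum_nonneg fun i _ => mul_self_nonneg (w i)
  rcases isEmpty_or_nonempty T with hT | hT
  · have h := coveringNumber_toNat_le_card (ρ := ρ) (ε := ε) ∅ fun x => isEmptyElim x
    rw [Finset.card_empty, Nat.le_zero] at h
    simp [h]
  change _ ≤ ∫ x, supportFn v x ∂piStdGaussian (Fin N)
  refine le_of_forall_gt_imp_ge_of_dense fun E hE => ?_
  have hE0 : 0 < E := (integral_supportFn_nonneg hv).trans_lt hE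
  have hself (t : T) : ρ t t = 0 := by simp [hsq]
  have hsymm (s t : T) : ρ s t = ρ t s := by
    rw [hsq, hsq, ← neg_sub, neg_dotProduct_neg]
  have hcont : Continuous fun p : T × T => ρ p.1 p.2 := by
    simp_rw [hsq]
    have h : Continuous fun p : T × T => v p.1 - v p.2 := by fun_prop
    exact (h.dotProduct h).sqrt
  obtain ⟨D, hD⟩ := (isCompact_range hcont).bddAbove
  obtain ⟨k, hk⟩ := pow_unbounded_of_one_lt (D / ε) one_lt_two
  obtain ⟨S, hS, hcard⟩ := exists_net_card_le_exp (B := 1024 * E ^ 2) hself hsymm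
    (fun s t => hD ⟨(s, t), rfl⟩) (by positivity)
    (fun r hr t₀ S hball hsep => card_le_exp_of_separated hv hE0 hE.le hr (v t₀) S
      (fun s hs => (Real.sqrt_le_left (by positivity)).1 (hsq s t₀ ▸ hball s hs))
      fun s hs t ht hst => (Real.le_sqrt' hr).1 (hsq s t ▸ hsep s hs t ht hst))
    k hε ((div_le_iff₀ hε).1 hk.le)
  have hlog : Real.log (coveringNumber ρ ε).toNat ≤ (46 * E / ε) ^ 2 := by
    rcases Nat.eq_zero_or_pos (coveringNumber ρ ε).toNat with h | h
    · rw [h]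
      simp
      positivity
    calc Real.log (coveringNumber ρ ε).toNat
        ≤ 2 * (1024 * E ^ 2) / ε ^ 2 :=
          (Real.log_le_iff_le_exp (by exact_mod_cast h)).2 <|
            (Nat.cast_le.2 (coveringNumber_toNat_le_card S hS)).trans hcard
      _ ≤ (46 * E / ε) ^ 2 := by
          rw [div_pow]
          gcongr
          nlinarith [sq_nonneg E]
  calc 1 / 46 * ε * Real.sqrt (Real.log (coveringNumber ρ ε).toNat)
      ≤ 1 / 46 * ε * (46 * E / ε) := by
        gcongr
        exact Real.sqrt_le_iff.2 ⟨by positivity, hlog⟩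
    _ = E := by field_simp
end

section
/- (Lévy concentration of measure on the sphere.) Let d ≥ 2, let S^d ⊂ ℝ^{d+1} be the unit sphere with its geodesic (round) distance, and let σ be the uniform probability measure on S^d. Let f : S^d → ℝ be Lipschitz with Lipschitz constant L > 0 (with respect to the geodesic distance), and let M be a median of f, i.e. σ({f ≤ M}) ≥ 1/2 and σ({f ≥ M}) ≥ 1/2. Then for every r > 0, σ({x ∈ S^d : |f(x) − M| ≥ r}) ≤ 2 exp(−(d−1) r²/(2 L²)). -/
open MeasureTheory

/-- The polarization (two-point rearrangement) of `K` towards the half-space `H` with respect to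
the involution `R`. -/
def polarization {α : Type*} (R : α → α) (H K : Set α) : Set α :=
  ((K ∪ R ⁻¹' K) ∩ H) ∪ (K ∩ R ⁻¹' K : Set α)

/-- `R` is an isometric involution folding the space onto the half-space `H`. -/
structure IsFolding {α : Type*} [PseudoMetricSpace α] (R : α → α) (H : Set α) : Prop where
  involutive : Function.Involutive R
  isometry : Isometry R
  isClosed : IsClosed H
  mem_or : ∀ x, x ∈ H ∨ R x ∈ H
  eq_of_mem : ∀ x, x ∈ H → R x ∈ H → R x = x
  dist_le : ∀ x y, x ∉ H → y ∈ H → dist (R x) y ≤ dist x y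

section Polarization

variable {α : Type*}

lemma polarization_mono (R : α → α) (H : Set α) {K K' : Set α} (h : K ⊆ K') :
    polarization R H K ⊆ polarization R H K' := by
  rintro x (⟨hx | hx, hH⟩ | ⟨hx, hx'⟩)
  · exact Or.inl ⟨Or.inl (h hx), hH⟩
  · exact Or.inl ⟨Or.inr (h hx), hH⟩
  · exact Or.inr ⟨h hx, h hx'⟩

variable [PseudoMetricSpace α] {R : α → α} {H : Set α}

lemma IsFolding.isClosed_polarization (hR : IsFolding R H) {K : Set α} (hK : IsClosed K) :
    IsClosed (polarization R H K) := by
  have := hK.preimage hR.isometry.continuous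
  exact ((hK.union this).inter hR.isClosed).union (hK.inter this)

lemma IsFolding.nonempty_polarization (hR : IsFolding R H) {K : Set α} (hK : K.Nonempty) :
    (polarization R H K).Nonempty := by
  obtain ⟨x, hx⟩ := hK
  rcases hR.mem_or x with h | h
  · exact ⟨x, Or.inl ⟨Or.inl hx, h⟩⟩
  · exact ⟨R x, Or.inl ⟨Or.inr (by simpa [hR.involutive x] using hx), h⟩⟩

lemma IsFolding.thickening_polarization_subset (hR : IsFolding R H) (δ : ℝ) (K : Set α) :
    Metric.thickening δ (polarization R H K) ⊆ polarization R H (Metric.thickening δ K) := by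
  intro x hx
  rw [Metric.mem_thickening_iff] at hx
  obtain ⟨y, hy, hxy⟩ := hx
  have key : ∀ u v, v ∈ K → dist u v < δ → u ∈ Metric.thickening δ K := fun u v hv h =>
    Metric.mem_thickening_iff.2 ⟨v, hv, h⟩
  have hRR : dist (R x) (R y) < δ := by rwa [hR.isometry.dist_eq]
  rcases hy with ⟨hy, hyH⟩ | ⟨hy, hy'⟩
  · by_cases hxH : x ∈ H
    · rcases hy with hy | hy
      · exact Or.inl ⟨Or.inl (key x y hy hxy), hxH⟩
      · exact Or.inl ⟨Or.inr (key (R x) (R y) hy hRR), hxH⟩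
    · have h1 : dist (R x) y < δ := (hR.dist_le x y hxH hyH).trans_lt hxy
      have h2 : dist x (R y) < δ := by
        rwa [← hR.isometry.dist_eq, hR.involutive y]
      rcases hy with hy | hy
      · exact Or.inr ⟨key _ _ hy hxy, key _ _ hy h1⟩
      · exact Or.inr ⟨key _ _ hy h2, key _ _ hy hRR⟩
  · exact Or.inr ⟨key _ _ hy hxy, key _ _ hy' hRR⟩

variable [MeasurableSpace α] [BorelSpace α] {μ : Measure α}

lemma IsFolding.measurableSet_polarization (hR : IsFolding R H) {K : Set α}
    (hK : MeasurableSet K) : MeasurableSet (polarization R H K) := by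
  have := hR.isometry.continuous.measurable hK
  exact ((hK.union this).inter hR.isClosed.measurableSet).union (hK.inter this)

lemma IsFolding.measure_polarization [IsFiniteMeasure μ] (hR : IsFolding R H)
    (hμ : MeasurePreserving R μ μ) {K : Set α} (hK : MeasurableSet K) :
    μ (polarization R H K) = μ K := by
  have hRR := hR.involutive
  have hP := hR.measurableSet_polarization hK
  have hunion : polarization R H K ∪ R ⁻¹' polarization R H K = K ∪ R ⁻¹' K := by
    ext x
    have h1 := hR.mem_or x
    simp only [polarization, Set.mem_union, Set.mem_inter_iff, Set.mem_preimage, hRR x]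
    tauto
  have hinter : polarization R H K ∩ R ⁻¹' polarization R H K = K ∩ R ⁻¹' K := by
    ext x
    have h1 : x ∈ H → R x ∈ H → (R x ∈ K ↔ x ∈ K) := fun a b => by rw [hR.eq_of_mem x a b]
    simp only [polarization, Set.mem_union, Set.mem_inter_iff, Set.mem_preimage, hRR x]
    tauto
  have e1 := measure_union_add_inter (μ := μ) (polarization R H K) (hμ.measurable hP)
  have e2 := measure_union_add_inter (μ := μ) K (hμ.measurable hK)
  rw [hunion, hinter, e2, hμ.measure_preimage hP.nullMeasurableSet,
    hμ.measure_preimage hK.nullMeasurableSet, ← two_mul, ← two_mul] at e1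
  exact ((ENNReal.mul_right_inj two_ne_zero ENNReal.ofNat_ne_top).1 e1).symm

/-- If `H` contains the centre of a cap `C`, polarizing a set that `R` can move partially into `C`
increases its overlap with `C`. -/
lemma IsFolding.measure_inter_lt_polarization [IsFiniteMeasure μ] (hR : IsFolding R H)
    (hμ : MeasurePreserving R μ μ) {K C : Set α} (hK : MeasurableSet K) (hC : MeasurableSet C)
    (hCH : ∀ x ∈ H, R x ∈ C → x ∈ C) (hpos : 0 < μ ((C \ K) ∩ R ⁻¹' (K \ C))) :
    μ (K ∩ C) < μ (polarization R H K ∩ C) := by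
  have hRR := hR.involutive
  set D := (C \ K) ∩ R ⁻¹' (K \ C) with hD
  have hDm : MeasurableSet D := (hC.diff hK).inter (hμ.measurable (hK.diff hC))
  have hdisj : Disjoint (polarization R H (K ∩ C)) D := by
    rw [Set.disjoint_left]
    rintro x (⟨hx | hx, -⟩ | ⟨hx, -⟩) ⟨⟨-, hxK⟩, -, hRC⟩
    · exact hxK hx.1
    · exact hRC hx.2
    · exact hxK hx.1
  have hsub : polarization R H (K ∩ C) ∪ D ⊆ polarization R H K ∩ C := by
    rintro x (hx | ⟨⟨hxC, hxK⟩, hRK, hRC⟩)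
    · refine ⟨polarization_mono R H Set.inter_subset_left hx, ?_⟩
      rcases hx with ⟨hx | hx, hxH⟩ | ⟨hx, -⟩
      · exact hx.2
      · exact hCH x hxH hx.2
      · exact hx.2
    · refine ⟨Or.inl ⟨Or.inr hRK, ?_⟩, hxC⟩
      by_contra hxH
      exact hRC (hCH _ ((hR.mem_or x).resolve_left hxH) (by rwa [hRR x]))
  calc μ (K ∩ C) = μ (polarization R H (K ∩ C)) := (hR.measure_polarization hμ (hK.inter hC)).symm
    _ < μ (polarization R H (K ∩ C)) + μ D :=
      ENNReal.lt_add_right (measure_ne_top _ _) hpos.ne'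
    _ = μ (polarization R H (K ∩ C) ∪ D) := (measure_union hdisj hDm).symm
    _ ≤ _ := measure_mono hsub

end Polarization

section Semicontinuity

open TopologicalSpace

variable {α : Type*} [MetricSpace α]

lemma continuous_infDist_nonemptyCompacts :
    Continuous fun p : NonemptyCompacts α × α => Metric.infDist p.2 (p.1 : Set α) :=
  (Metric.lipschitz_infDist (α := α)).continuous.comp
    (f := fun p : NonemptyCompacts α × α => (p.2, p.1)) (continuous_snd.prodMk continuous_fst)

lemma eventually_subset_thickening (δ : ℝ) (K : NonemptyCompacts α) {F : Set α} (hF : IsCompact F)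
    (hFK : F ⊆ Metric.thickening δ (K : Set α)) :
    ∀ᶠ K' : NonemptyCompacts α in nhds K, F ⊆ Metric.thickening δ (K' : Set α) := by
  have hev : ∀ᶠ K' : NonemptyCompacts α in nhds K,
      ∀ x ∈ F, Metric.infDist x (K' : Set α) < δ := by
    refine hF.eventually_forall_of_forall_eventually fun x hx => ?_
    have hlt := (Metric.mem_thickening_iff_infDist_lt K.nonempty).1 (hFK hx)
    have hcont := (continuous_infDist_nonemptyCompacts (α := α)).tendsto (K, x)
    exact hcont.eventually_lt_const hlt
  filter_upwards [hev] with K' hK' x hx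
  exact (Metric.mem_thickening_iff_infDist_lt K'.nonempty).2 (hK' x hx)

variable [CompactSpace α] [MeasurableSpace α] [BorelSpace α]

lemma upperSemicontinuous_measure_nonemptyCompacts (ν : Measure α) [IsFiniteMeasure ν] :
    UpperSemicontinuous fun K : NonemptyCompacts α => ν (K : Set α) := by
  intro K c hc
  obtain ⟨U, hKU, hU, hUc⟩ := (K : Set α).exists_isOpen_lt_of_lt c hc
  filter_upwards [(NonemptyCompacts.isOpen_subsets_of_isOpen hU).mem_nhds hKU] with K' hK'
  exact (measure_mono hK').trans_lt hUc

lemma lowerSemicontinuous_measure_thickening (ν : Measure α) [IsFiniteMeasure ν] (δ : ℝ) :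
    LowerSemicontinuous fun K : NonemptyCompacts α => ν (Metric.thickening δ (K : Set α)) := by
  intro K c hc
  obtain ⟨F, hFK, hF, hFc⟩ := (Metric.isOpen_thickening (δ := δ)).exists_lt_isCompact hc
  filter_upwards [eventually_subset_thickening δ K hF hFK] with K' hKK
  exact hFc.trans_le (measure_mono hKK)

/-- If any closed set not covering the set `C` can be polarized to overlap more with `C`, then
some closed set almost covers `C` without having larger neighbourhoods than `A`. -/
lemma exists_isClosed_almost_cover (μ : Measure α) [IsFiniteMeasure μ] {A C : Set α}
    (hA : IsClosed A) (hAne : A.Nonempty) (hC : IsClosed C) (hCA : μ C ≤ μ A) (δ : ℝ)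
    (hpol : ∀ K : Set α, IsClosed K → 0 < μ (C \ K) → 0 < μ (K \ C) →
      ∃ R H, IsFolding R H ∧ MeasurePreserving R μ μ ∧ (∀ x ∈ H, R x ∈ C → x ∈ C) ∧
        0 < μ ((C \ K) ∩ R ⁻¹' (K \ C))) :
    ∃ K : Set α, IsClosed K ∧ μ (C \ K) = 0 ∧
      μ (Metric.thickening δ K) ≤ μ (Metric.thickening δ A) := by
  let S : Set (NonemptyCompacts α) := {K | μ A ≤ μ (K : Set α)} ∩
    {K | μ (Metric.thickening δ (K : Set α)) ≤ μ (Metric.thickening δ A)}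
  have hS : IsCompact S :=
    (((upperSemicontinuous_measure_nonemptyCompacts μ).isClosed_preimage (μ A)).inter
      ((lowerSemicontinuous_measure_thickening μ δ).isClosed_preimage _)).isCompact
  have hSne : S.Nonempty :=
    ⟨⟨⟨A, hA.isCompact⟩, hAne⟩, le_refl (μ A), le_refl (μ (Metric.thickening δ A))⟩
  obtain ⟨K, ⟨hK1, hK2⟩, hmax⟩ := ((upperSemicontinuous_measure_nonemptyCompacts
    (μ.restrict C)).upperSemicontinuousOn S).exists_isMaxOn hSne hS
  have hKc : IsClosed (K : Set α) := K.isCompact.isClosed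
  refine ⟨K, hKc, ?_, hK2⟩
  by_contra h0
  have hpos : 0 < μ (C \ K) := pos_iff_ne_zero.2 h0
  have hpos' : 0 < μ ((K : Set α) \ C) := by
    refine hpos.trans_le ?_
    have e1 := measure_sdiff_add_inter (μ := μ) C hKc.measurableSet
    have e2 := measure_sdiff_add_inter (μ := μ) (K : Set α) hC.measurableSet
    rw [Set.inter_comm] at e2
    refine (ENNReal.add_le_add_iff_right (measure_ne_top μ (C ∩ K))).1 ?_
    rw [e1, e2]
    exact hCA.trans hK1
  obtain ⟨R, H, hR, hμ, hCH, hD⟩ := hpol K hKc hpos hpos'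
  let K' : NonemptyCompacts α := ⟨⟨polarization R H K, (hR.isClosed_polarization hKc).isCompact⟩,
    hR.nonempty_polarization K.nonempty⟩
  have hK' : K' ∈ S := by
    constructor
    · exact hK1.trans_eq (hR.measure_polarization hμ hKc.measurableSet).symm
    · refine le_trans ?_ (show μ (Metric.thickening δ (K : Set α)) ≤ _ from hK2)
      exact (measure_mono (hR.thickening_polarization_subset δ K)).trans_eq
        (hR.measure_polarization hμ Metric.isOpen_thickening.measurableSet)
  have h1 := hmax hK'
  simp only [Set.mem_ofPred_eq] at h1
  rw [Measure.restrict_apply hKc.measurableSet,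
    Measure.restrict_apply K'.isCompact.isClosed.measurableSet] at h1
  exact absurd h1 (not_le.2
    (hR.measure_inter_lt_polarization hμ hKc.measurableSet hC.measurableSet hCH hD))

end Semicontinuity

section Sphere

open scoped RealInnerProductSpace

variable {V : Type*} [NormedAddCommGroup V] [InnerProductSpace ℝ V]

/-- The action of a linear isometry on the unit sphere. -/
def LinearIsometryEquiv.sphereMap (e : V ≃ₗᵢ[ℝ] V) (x : Metric.sphere (0 : V) 1) :
    Metric.sphere (0 : V) 1 :=
  ⟨e x, by simp⟩

lemma LinearIsometryEquiv.isometry_sphereMap (e : V ≃ₗᵢ[ℝ] V) : Isometry e.sphereMap :=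
  Isometry.of_dist_eq fun x y => e.dist_map x y

lemma dist_sphere_sq (x y : Metric.sphere (0 : V) 1) :
    dist x y ^ 2 = 2 - 2 * ⟪(x : V), (y : V)⟫ := by
  rw [Subtype.dist_eq, dist_eq_norm, norm_sub_sq_real]
  simp
  ring

lemma dist_sphere_le_iff (x y z : Metric.sphere (0 : V) 1) :
    dist x z ≤ dist y z ↔ ⟪(y : V), (z : V)⟫ ≤ ⟪(x : V), (z : V)⟫ := by
  rw [← sq_le_sq₀ dist_nonneg dist_nonneg, dist_sphere_sq, dist_sphere_sq]
  constructor <;> intro h <;> linarith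

lemma reflection_orthogonal_singleton_apply (w x : V) :
    (ℝ ∙ w)ᗮ.reflection x = x - (2 * (⟪w, x⟫ / ‖w‖ ^ 2)) • w := by
  rw [Submodule.reflection_orthogonal_apply, Submodule.reflection_singleton_apply]
  simp [mul_smul, two_smul]

lemma isFolding_reflection {w : V} (hw : w ≠ 0) :
    IsFolding (ℝ ∙ w)ᗮ.reflection.sphereMap {x : Metric.sphere (0 : V) 1 | ⟪w, (x : V)⟫ ≤ 0} := by
  have hw' : 0 < ‖w‖ ^ 2 := by positivity
  have hinner (x : Metric.sphere (0 : V) 1) :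
      ⟪w, ((ℝ ∙ w)ᗮ.reflection.sphereMap x : V)⟫ = -⟪w, (x : V)⟫ := by
    simp only [LinearIsometryEquiv.sphereMap, reflection_orthogonal_singleton_apply,
      inner_sub_right, inner_smul_right, real_inner_self_eq_norm_sq]
    field_simp
    ring
  refine ⟨fun x => Subtype.ext (Submodule.reflection_reflection _ _),
    LinearIsometryEquiv.isometry_sphereMap _,
    isClosed_le (by fun_prop) continuous_const, fun x => ?_, fun x h1 h2 => ?_, fun x y h1 h2 => ?_⟩
  · simp only [Set.mem_ofPred_eq, hinner]
    rcases le_total ⟪w, (x : V)⟫ 0 with h | h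
    · exact Or.inl h
    · exact Or.inr (by linarith)
  · simp only [Set.mem_ofPred_eq, hinner] at h1 h2
    have h0 : ⟪w, (x : V)⟫ = 0 := by linarith
    refine Subtype.ext ?_
    simp [LinearIsometryEquiv.sphereMap, reflection_orthogonal_singleton_apply, h0]
  · simp only [Set.mem_ofPred_eq, not_le] at h1 h2
    rw [dist_sphere_le_iff]
    simp only [LinearIsometryEquiv.sphereMap, reflection_orthogonal_singleton_apply,
      inner_sub_left, real_inner_smul_left]
    have : ⟪w, (x : V)⟫ / ‖w‖ ^ 2 * ⟪w, (y : V)⟫ ≤ 0 :=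
      mul_nonpos_of_nonneg_of_nonpos (by positivity) h2
    nlinarith

lemma sphereMap_reflection_sub (x y : Metric.sphere (0 : V) 1) :
    (ℝ ∙ ((x : V) - y))ᗮ.reflection.sphereMap y = x := by
  have h : (ℝ ∙ ((x : V) - y))ᗮ.reflection (x : V) = y := Submodule.reflection_sub (by simp)
  have h' := congrArg (ℝ ∙ ((x : V) - y))ᗮ.reflection h
  rw [Submodule.reflection_reflection] at h'
  exact Subtype.ext h'.symm

lemma exists_sphereMap_eq (x y : Metric.sphere (0 : V) 1) :
    ∃ e : V ≃ₗᵢ[ℝ] V, e.sphereMap x = y :=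
  ⟨_, sphereMap_reflection_sub y x⟩

variable [FiniteDimensional ℝ V] [MeasurableSpace V] [BorelSpace V]

lemma exists_density_points {μ : Measure (Metric.sphere (0 : V) 1)} [IsFiniteMeasure μ]
    (hμ : ∀ e : V ≃ₗᵢ[ℝ] V, MeasurePreserving e.sphereMap μ μ)
    {P Q : Set (Metric.sphere (0 : V) 1)} (hP : MeasurableSet P) (hQ : MeasurableSet Q)
    (hP0 : 0 < μ P) (hQ0 : 0 < μ Q) :
    ∃ b ∈ P, ∃ c ∈ Q, ∀ e : V ≃ₗᵢ[ℝ] V, e.sphereMap c = b → 0 < μ (Q ∩ e.sphereMap ⁻¹' P) := by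
  have hval := MeasurableEmbedding.subtype_coe
    (Metric.isClosed_sphere (x := (0 : V)) (ε := 1)).measurableSet
  have hdens : ∀ S : Set (Metric.sphere (0 : V) 1), MeasurableSet S → 0 < μ S →
      ∃ x ∈ S, ∀ᶠ r in nhdsWithin 0 (Set.Ioi (0 : ℝ)),
        2⁻¹ < μ (S ∩ Metric.closedBall x r) / μ (Metric.closedBall x r) := by
    intro S hS hS0
    have h := Besicovitch.ae_tendsto_measure_inter_div_of_measurableSet
      (μ.map (Subtype.val : Metric.sphere (0 : V) 1 → V)) (hval.measurableSet_image.2 hS)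
    rw [hval.ae_map_iff] at h
    obtain ⟨x, hxS, hx⟩ := Measure.exists_mem_of_measure_ne_zero_of_ae hS0.ne' (ae_restrict_of_ae h)
    refine ⟨x, hxS, ?_⟩
    rw [Set.indicator_of_mem (Set.mem_image_of_mem _ hxS)] at hx
    filter_upwards [hx.eventually_const_lt (u := 2⁻¹) (by simp)] with r hr
    rw [hval.map_apply, hval.map_apply, Set.preimage_inter,
      Set.preimage_image_eq _ Subtype.val_injective] at hr
    exact hr
  obtain ⟨b, hb, hb'⟩ := hdens P hP hP0
  obtain ⟨c, hc, hc'⟩ := hdens Q hQ hQ0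
  refine ⟨b, hb, c, hc, fun e he => ?_⟩
  obtain ⟨r, hrb, hrc⟩ := (hb'.and hc').exists
  have hball : e.sphereMap ⁻¹' Metric.closedBall b r = Metric.closedBall c r := by
    rw [← he, e.isometry_sphereMap.preimage_closedBall]
  have hmeas : MeasurableSet (Metric.closedBall b r) := Metric.isClosed_closedBall.measurableSet
  have hm : μ (Metric.closedBall b r) = μ (Metric.closedBall c r) := by
    rw [← hball, (hμ e).measure_preimage hmeas.nullMeasurableSet]
  have hmP : μ (P ∩ Metric.closedBall b r) = μ (e.sphereMap ⁻¹' P ∩ Metric.closedBall c r) := by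
    rw [← hball, ← Set.preimage_inter, (hμ e).measure_preimage (hP.inter hmeas).nullMeasurableSet]
  rw [hmP, hm] at hrb
  set B := Metric.closedBall c r
  have hB0 : μ B ≠ 0 := by
    intro h
    have : μ (Q ∩ B) = 0 := measure_mono_null Set.inter_subset_right h
    simp [this] at hrc
  rw [ENNReal.lt_div_iff_mul_lt (Or.inl hB0) (Or.inl (measure_ne_top _ _))] at hrb hrc
  by_contra h0
  have hnull : μ ((Q ∩ B) ∩ (e.sphereMap ⁻¹' P ∩ B)) = 0 :=
    measure_mono_null (Set.inter_subset_inter Set.inter_subset_left Set.inter_subset_left)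
      (nonpos_iff_eq_zero.1 (not_lt.1 h0))
  have hB : MeasurableSet B := Metric.isClosed_closedBall.measurableSet
  have hsum := measure_union_add_inter (μ := μ) (Q ∩ B) (((hμ e).measurable hP).inter hB)
  have hle : μ ((Q ∩ B) ∪ (e.sphereMap ⁻¹' P ∩ B)) ≤ μ B :=
    measure_mono (Set.union_subset Set.inter_subset_right Set.inter_subset_right)
  rw [hnull, add_zero] at hsum
  rw [hsum] at hle
  have := (ENNReal.add_lt_add hrc hrb).trans_le hle
  rw [← add_mul, ENNReal.inv_two_add_inv_two, one_mul] at this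
  exact lt_irrefl _ this

lemma eq_empty_of_isOpen_of_measure_zero {μ : Measure (Metric.sphere (0 : V) 1)}
    [IsProbabilityMeasure μ] (hμ : ∀ e : V ≃ₗᵢ[ℝ] V, MeasurePreserving e.sphereMap μ μ)
    {U : Set (Metric.sphere (0 : V) 1)} (hU : IsOpen U) (h0 : μ U = 0) : U = ∅ := by
  by_contra hne
  obtain ⟨x, hx⟩ := Set.nonempty_iff_ne_empty.2 hne
  have : μ Set.univ = 0 := by
    refine isCompact_univ.measure_zero_of_nhdsWithin fun y _ => ?_
    obtain ⟨e, he⟩ := exists_sphereMap_eq y x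
    refine ⟨e.sphereMap ⁻¹' U, ?_, ?_⟩
    · rw [nhdsWithin_univ]
      exact (hU.preimage e.isometry_sphereMap.continuous).mem_nhds (by simpa [he] using hx)
    · rw [(hμ e).measure_preimage hU.measurableSet.nullMeasurableSet, h0]
  simp at this

/-- Neighbourhoods of a cap slightly smaller than a hemisphere are no larger than those of a set
of measure at least `1 / 2`. -/
lemma measure_thickening_cap_le {μ : Measure (Metric.sphere (0 : V) 1)}
    [IsProbabilityMeasure μ] (hμ : ∀ e : V ≃ₗᵢ[ℝ] V, MeasurePreserving e.sphereMap μ μ)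
    {A : Set (Metric.sphere (0 : V) 1)} (hA : IsClosed A) (hA2 : 1 / 2 ≤ μ A)
    (p : Metric.sphere (0 : V) 1) {ε : ℝ} (hε : 0 < ε) (δ : ℝ) :
    μ (Metric.thickening δ {x | ε < ⟪(x : V), (p : V)⟫}) ≤ μ (Metric.thickening δ A) := by
  set C : Set (Metric.sphere (0 : V) 1) := {x | ε ≤ ⟪(x : V), (p : V)⟫} with hC
  have hCc : IsClosed C := isClosed_le continuous_const (by fun_prop)
  have hC2 : μ C ≤ 1 / 2 := by
    have hneg :=
      (hμ (LinearIsometryEquiv.neg ℝ)).measure_preimage hCc.measurableSet.nullMeasurableSet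
    have hdisj : Disjoint C ((LinearIsometryEquiv.neg ℝ).sphereMap ⁻¹' C) := by
      rw [Set.disjoint_left]
      intro x hx hx'
      simp only [hC, Set.mem_preimage, Set.mem_ofPred_eq, LinearIsometryEquiv.sphereMap,
        LinearIsometryEquiv.coe_neg, inner_neg_left] at hx hx'
      linarith
    have hle := (measure_union hdisj ((hμ (LinearIsometryEquiv.neg ℝ)).measurable
      hCc.measurableSet)).symm.trans_le (prob_le_one (μ := μ))
    rw [hneg, ← mul_two] at hle
    rwa [ENNReal.le_div_iff_mul_le (by simp) (by simp)]
  have hAne : A.Nonempty := by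
    refine nonempty_of_measure_ne_zero (μ := μ) fun h => ?_
    simp [h] at hA2
  obtain ⟨K, hK, hCK, hKA⟩ := exists_isClosed_almost_cover μ hA hAne hCc (hC2.trans hA2) δ
    fun K hK h1 h2 => by
      obtain ⟨b, hb, c, hc, hbc⟩ := exists_density_points hμ
        (hK.measurableSet.diff hCc.measurableSet) (hCc.measurableSet.diff hK.measurableSet) h2 h1
      have hlt : ⟪(b : V), (p : V)⟫ < ⟪(c : V), (p : V)⟫ := (not_le.1 hb.2).trans_le hc.1
      have hne : (b : V) - c ≠ 0 := by
        intro h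
        rw [sub_eq_zero.1 h] at hlt
        exact lt_irrefl _ hlt
      refine ⟨_, _, isFolding_reflection hne, hμ _, fun x hx hxC => ?_, hbc _ ?_⟩
      · simp only [hC, Set.mem_ofPred_eq, LinearIsometryEquiv.sphereMap,
          reflection_orthogonal_singleton_apply] at hx hxC ⊢
        rw [inner_sub_left, real_inner_smul_left, inner_sub_left (b : V) (c : V) (p : V)] at hxC
        have h3 : ⟪(b : V) - c, (x : V)⟫ / ‖(b : V) - c‖ ^ 2 ≤ 0 :=
          div_nonpos_of_nonpos_of_nonneg hx (by positivity)
        nlinarith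
      · exact sphereMap_reflection_sub b c
  refine (measure_mono (Metric.thickening_subset_of_subset δ ?_)).trans hKA
  have hopen : IsOpen {x : Metric.sphere (0 : V) 1 | ε < ⟪(x : V), (p : V)⟫} :=
    isOpen_lt continuous_const (by fun_prop)
  have := eq_empty_of_isOpen_of_measure_zero hμ (hopen.sdiff hK)
    (measure_mono_null (Set.sdiff_subset_sdiff_left (Set.ofPred_subset_ofPred.2 fun x => le_of_lt))
      hCK)
  exact Set.sdiff_eq_empty.1 this

end Sphere

section CapMeasure

open scoped RealInnerProductSpace

/-- Integration of radial functions in polar coordinates. -/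
lemma lintegral_fun_norm_addHaar {E : Type*} [NormedAddCommGroup E] [NormedSpace ℝ E]
    [Nontrivial E] [FiniteDimensional ℝ E] [MeasurableSpace E] [BorelSpace E] (ν : Measure E)
    [ν.IsAddHaarMeasure] {g : ℝ → ENNReal} (hg : Measurable g) :
    ∫⁻ y, g ‖y‖ ∂ν = ν.toSphere Set.univ *
      ∫⁻ s in Set.Ioi (0 : ℝ), ENNReal.ofReal (s ^ (Module.finrank ℝ E - 1)) * g s :=
  calc
    ∫⁻ y, g ‖y‖ ∂ν = ∫⁻ y : ({(0)}ᶜ : Set E), g ‖y.1‖ ∂(ν.comap (↑)) := by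
      rw [lintegral_subtype_comap (measurableSet_singleton _).compl fun y ↦ g ‖y‖,
        restrict_compl_singleton]
    _ = ∫⁻ y, g y.2 ∂ν.toSphere.prod (.volumeIoiPow (Module.finrank ℝ E - 1)) := by
      simpa using ν.measurePreserving_homeomorphUnitSphereProd.lintegral_comp_emb
        (Homeomorph.measurableEmbedding _) (g ∘ Subtype.val ∘ Prod.snd)
    _ = ν.toSphere Set.univ *
        ∫⁻ s : Set.Ioi (0 : ℝ), g s ∂.volumeIoiPow (Module.finrank ℝ E - 1) := by
      rw [lintegral_prod _ (by fun_prop)]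
      simp [mul_comm]
    _ = _ := by
      congr 1
      refine (lintegral_withDensity_eq_lintegral_mul _ (by fun_prop)
        (hg.comp measurable_subtype_coe)).trans ?_
      exact lintegral_subtype_comap measurableSet_Ioi
        fun s ↦ ENNReal.ofReal (s ^ (Module.finrank ℝ E - 1)) * g s

/-- The volume of a rotation-symmetric set is given by a weighted area of its profile. -/
lemma exists_volume_profile (d : ℕ) (hd : d ≠ 0) :
    ∃ c : ENNReal, ∀ S : Set (ℝ × ℝ), MeasurableSet S →
      volume {y : EuclideanSpace ℝ (Fin (d + 1)) |
        (y 0, ‖WithLp.toLp 2 (Fin.tail y.ofLp)‖) ∈ S} =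
      c * ∫⁻ z : ℂ, {z : ℂ | 0 < z.im ∧ (z.re, z.im) ∈ S}.indicator
        (fun z => ENNReal.ofReal (z.im ^ (d - 1))) z := by
  have : Nonempty (Fin d) := ⟨⟨0, Nat.pos_of_ne_zero hd⟩⟩
  refine ⟨(volume : Measure (EuclideanSpace ℝ (Fin d))).toSphere Set.univ, fun S hS => ?_⟩
  have hmp : MeasurePreserving (fun q : ℝ × EuclideanSpace ℝ (Fin d) =>
      (WithLp.toLp 2 (Fin.cons q.1 q.2.ofLp) : EuclideanSpace ℝ (Fin (d + 1)))) := by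
    have h1 := (MeasurePreserving.id (volume : Measure ℝ)).prod
      (PiLp.volume_preserving_ofLp (Fin d))
    have h2 := (volume_preserving_piFinSuccAbove (fun _ : Fin (d + 1) => ℝ) 0).symm
    have h3 := PiLp.volume_preserving_toLp (Fin (d + 1))
    convert h3.comp (h2.comp h1) using 1
    · ext q : 1
      simp [MeasurableEquiv.piFinSuccAbove, Fin.insertNthEquiv, Fin.insertNth_zero']
    · rfl
  have hmS : MeasurableSet {y : EuclideanSpace ℝ (Fin (d + 1)) |
      (y 0, ‖WithLp.toLp 2 (Fin.tail y.ofLp)‖) ∈ S} := by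
    refine hS.preimage (Measurable.prodMk (by fun_prop) ?_)
    refine Continuous.measurable ?_
    unfold Fin.tail
    fun_prop
  rw [← hmp.measure_preimage hmS.nullMeasurableSet]
  have hpre : (fun q : ℝ × EuclideanSpace ℝ (Fin d) =>
      (WithLp.toLp 2 (Fin.cons q.1 q.2.ofLp) : EuclideanSpace ℝ (Fin (d + 1)))) ⁻¹'
      {y | (y 0, ‖WithLp.toLp 2 (Fin.tail y.ofLp)‖) ∈ S} = {q | (q.1, ‖q.2‖) ∈ S} := by
    ext q
    simp
  have hmq : MeasurableSet {q : ℝ × EuclideanSpace ℝ (Fin d) | (q.1, ‖q.2‖) ∈ S} :=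
    hS.preimage (f := fun q : ℝ × EuclideanSpace ℝ (Fin d) => (q.1, ‖q.2‖)) (by fun_prop)
  rw [hpre, Measure.volume_eq_prod, Measure.prod_apply hmq]
  have hsec (x : ℝ) : volume (Prod.mk x ⁻¹' {q : ℝ × EuclideanSpace ℝ (Fin d) | (q.1, ‖q.2‖) ∈ S}) =
      (volume : Measure (EuclideanSpace ℝ (Fin d))).toSphere Set.univ *
      ∫⁻ s in Set.Ioi (0 : ℝ), ENNReal.ofReal (s ^ (d - 1)) *
        (Prod.mk x ⁻¹' S).indicator 1 s := by
    have hSx : MeasurableSet (Prod.mk x ⁻¹' S) := hS.preimage (by fun_prop)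
    have h := lintegral_fun_norm_addHaar (volume : Measure (EuclideanSpace ℝ (Fin d)))
      (measurable_one.indicator hSx)
    rw [finrank_euclideanSpace_fin] at h
    rw [← h]
    exact (lintegral_indicator_one (hSx.preimage measurable_norm)).symm
  simp_rw [hsec]
  have hmeas : MeasurableSet {z : ℂ | 0 < z.im ∧ (z.re, z.im) ∈ S} :=
    (measurableSet_lt measurable_const Complex.measurable_im).inter
      (hS.preimage (by fun_prop))
  rw [lintegral_const_mul' _ _ (measure_ne_top _ _),
    ← Complex.volume_preserving_equiv_real_prod.symm.lintegral_comp_emb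
      (MeasurableEquiv.measurableEmbedding _), Measure.volume_eq_prod, lintegral_prod]
  · congr 1
    refine lintegral_congr fun x => ?_
    rw [← lintegral_indicator measurableSet_Ioi]
    refine lintegral_congr fun s => ?_
    simp only [Set.indicator_apply]
    by_cases hs : 0 < s <;> by_cases hxs : (x, s) ∈ S <;> simp [hs, hxs]
  · have hF :=
      (by fun_prop : Measurable fun z : ℂ => ENNReal.ofReal (z.im ^ (d - 1))).indicator hmeas
    exact (hF.comp Complex.measurableEquivRealProd.symm.measurable).aemeasurable

/-- The profile of the intersection of the unit ball with the cone of half-angle `π / 2 - t`. -/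
def coneProfile (t : ℝ) : Set (ℝ × ℝ) :=
  {q | q.1 ^ 2 + q.2 ^ 2 < 1 ∧ q.2 * Real.sin t ≤ q.1 * Real.cos t ∧ 0 ≤ q.1}

lemma measurableSet_coneProfile (t : ℝ) : MeasurableSet (coneProfile t) := by
  have h1 : MeasurableSet {q : ℝ × ℝ | q.1 ^ 2 + q.2 ^ 2 < 1} :=
    measurableSet_lt (by fun_prop) measurable_const
  have h2 : MeasurableSet {q : ℝ × ℝ | q.2 * Real.sin t ≤ q.1 * Real.cos t} :=
    measurableSet_le (by fun_prop) (by fun_prop)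
  exact h1.inter (h2.inter (measurableSet_le measurable_const measurable_fst))

lemma lintegral_coneProfile_le (n : ℕ) {t : ℝ} (h0 : 0 ≤ t) (ht : t ≤ Real.pi / 2) :
    ∫⁻ z : ℂ, {z : ℂ | 0 < z.im ∧ (z.re, z.im) ∈ coneProfile t}.indicator
        (fun z => ENNReal.ofReal (z.im ^ n)) z ≤
      ENNReal.ofReal (Real.cos t ^ n) *
        ∫⁻ z : ℂ, {z : ℂ | 0 < z.im ∧ (z.re, z.im) ∈ coneProfile 0}.indicator
          (fun z => ENNReal.ofReal (z.im ^ n)) z := by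
  have hcos : 0 ≤ Real.cos t := Real.cos_nonneg_of_mem_Icc ⟨by linarith, ht⟩
  have hsin : 0 ≤ Real.sin t := Real.sin_nonneg_of_nonneg_of_le_pi h0 (by linarith [Real.pi_pos])
  rw [← lintegral_const_mul' _ _ ENNReal.ofReal_ne_top]
  refine le_trans ?_ ((rotation (Circle.exp t)).measurePreserving.lintegral_comp_emb
      (rotation (Circle.exp t)).toMeasurableEquiv.measurableEmbedding _).le
  refine lintegral_mono fun z => ?_
  have hre : (rotation (Circle.exp t) z).re = Real.cos t * z.re - Real.sin t * z.im := by
    simp [rotation_apply, Circle.coe_exp, Complex.exp_ofReal_mul_I_re, Complex.exp_ofReal_mul_I_im]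
  have him : (rotation (Circle.exp t) z).im = Real.cos t * z.im + Real.sin t * z.re := by
    simp [rotation_apply, Circle.coe_exp, Complex.exp_ofReal_mul_I_re, Complex.exp_ofReal_mul_I_im]
  by_cases hz : 0 < z.im ∧ (z.re, z.im) ∈ coneProfile t
  swap
  · rw [Set.indicator_of_notMem
      (s := {z : ℂ | 0 < z.im ∧ (z.re, z.im) ∈ coneProfile t}) hz]
    exact zero_le
  have hz' := hz
  obtain ⟨hs, hball, hcone, hx⟩ := hz
  simp only at hball hcone hx
  have hsq := Real.sin_sq_add_cos_sq t
  have hre0 : 0 ≤ (rotation (Circle.exp t) z).re := by rw [hre]; linarith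
  have hid : z.im = Real.cos t * (rotation (Circle.exp t) z).im -
      Real.sin t * (rotation (Circle.exp t) z).re := by
    rw [hre, him]
    linear_combination (-z.im) * hsq
  have hle : z.im ≤ Real.cos t * (rotation (Circle.exp t) z).im := by
    have := mul_nonneg hsin hre0
    linarith
  have him0 : 0 < (rotation (Circle.exp t) z).im := pos_of_mul_pos_right (hs.trans_le hle) hcos
  have hw : 0 < (rotation (Circle.exp t) z).im ∧
      ((rotation (Circle.exp t) z).re, (rotation (Circle.exp t) z).im) ∈ coneProfile 0 := by
    refine ⟨him0, ?_, ?_, hre0⟩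
    · simp only [hre, him]
      calc _ = (z.re ^ 2 + z.im ^ 2) * (Real.sin t ^ 2 + Real.cos t ^ 2) := by ring
        _ < 1 := by rwa [hsq, mul_one]
    · simpa using hre0
  rw [Set.indicator_of_mem (s := {z : ℂ | 0 < z.im ∧ (z.re, z.im) ∈ coneProfile t}) hz',
    Set.indicator_of_mem (s := {z : ℂ | 0 < z.im ∧ (z.re, z.im) ∈ coneProfile 0}) hw,
    ← ENNReal.ofReal_mul (pow_nonneg hcos n),
    ← mul_pow]
  exact ENNReal.ofReal_le_ofReal (pow_le_pow_left₀ hs.le hle n)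

/-- The volume of the part of a cone of half-angle `π / 2 - t` in the unit ball. -/
lemma volume_cone_le (d : ℕ) (hd : d ≠ 0) {t : ℝ} (h0 : 0 ≤ t) (ht : t ≤ Real.pi / 2) :
    volume (Metric.ball (0 : EuclideanSpace ℝ (Fin (d + 1))) 1 ∩
      {y | Real.sin t * ‖y‖ ≤ ⟪EuclideanSpace.single 0 1, y⟫}) ≤
    ENNReal.ofReal (Real.cos t ^ (d - 1)) *
      volume (Metric.ball (0 : EuclideanSpace ℝ (Fin (d + 1))) 1) := by
  have hcos : 0 ≤ Real.cos t := Real.cos_nonneg_of_mem_Icc ⟨by linarith, ht⟩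
  have hsin : 0 ≤ Real.sin t := Real.sin_nonneg_of_nonneg_of_le_pi h0 (by linarith [Real.pi_pos])
  have hsq := Real.sin_sq_add_cos_sq t
  have hnorm (y : EuclideanSpace ℝ (Fin (d + 1))) :
      ‖y‖ ^ 2 = y 0 ^ 2 + ‖WithLp.toLp 2 (Fin.tail y.ofLp)‖ ^ 2 := by
    simp [EuclideanSpace.norm_sq_eq, Fin.sum_univ_succ, Fin.tail]
  obtain ⟨c, hc⟩ := exists_volume_profile d hd
  have h1 : volume (Metric.ball (0 : EuclideanSpace ℝ (Fin (d + 1))) 1 ∩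
      {y | Real.sin t * ‖y‖ ≤ ⟪EuclideanSpace.single 0 1, y⟫}) ≤
      volume {y : EuclideanSpace ℝ (Fin (d + 1)) |
        (y 0, ‖WithLp.toLp 2 (Fin.tail y.ofLp)‖) ∈ coneProfile t} := by
    refine measure_mono ?_
    rintro y ⟨hy1, hy2⟩
    simp only [Set.mem_ofPred_eq, EuclideanSpace.inner_single_left, map_one, one_mul] at hy2
    rw [mem_ball_zero_iff] at hy1
    have hy0 : 0 ≤ y 0 := (mul_nonneg hsin (norm_nonneg y)).trans hy2
    refine ⟨?_, ?_, hy0⟩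
    · simp only
      rw [← hnorm]
      exact pow_lt_one₀ (norm_nonneg _) hy1 two_ne_zero
    · refine le_of_sq_le_sq ?_ (mul_nonneg hy0 hcos)
      have h := pow_le_pow_left₀ (mul_nonneg hsin (norm_nonneg y)) hy2 2
      rw [mul_pow, hnorm] at h
      simp only
      nlinarith
  have h2 : volume {y : EuclideanSpace ℝ (Fin (d + 1)) |
        (y 0, ‖WithLp.toLp 2 (Fin.tail y.ofLp)‖) ∈ coneProfile 0} ≤
      volume (Metric.ball (0 : EuclideanSpace ℝ (Fin (d + 1))) 1) := by
    refine measure_mono ?_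
    rintro y ⟨hy, -⟩
    simp only at hy
    rw [← hnorm] at hy
    rw [mem_ball_zero_iff]
    exact (sq_lt_one_iff₀ (norm_nonneg _)).1 hy
  refine h1.trans ?_
  refine le_trans ?_ (mul_le_mul_right h2 _)
  rw [hc _ (measurableSet_coneProfile t), hc _ (measurableSet_coneProfile 0), mul_left_comm]
  exact mul_le_mul_right (lintegral_coneProfile_le (d - 1) h0 ht) _

/-- The measure of a cap equals the proportion of the unit ball in the cone over the cap. -/
lemma measure_cap_mul_volume_ball {V : Type*} [NormedAddCommGroup V] [InnerProductSpace ℝ V]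
    [FiniteDimensional ℝ V] [Nontrivial V] [MeasurableSpace V] [BorelSpace V]
    {μ : Measure (Metric.sphere (0 : V) 1)} [IsProbabilityMeasure μ]
    (hμ : ∀ e : V ≃ₗᵢ[ℝ] V, MeasurePreserving e.sphereMap μ μ)
    (p q : Metric.sphere (0 : V) 1) (c : ℝ) :
    μ {x | c ≤ ⟪(x : V), (p : V)⟫} * volume (Metric.ball (0 : V) 1) =
      volume (Metric.ball (0 : V) 1 ∩ {y | c * ‖y‖ ≤ ⟪(q : V), y⟫}) := by
  set ν := volume.restrict (Metric.ball (0 : V) 1) with hν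
  have : IsFiniteMeasure ν := ⟨by simpa [hν] using measure_ball_lt_top⟩
  have hT : MeasurableSet {z : Metric.sphere (0 : V) 1 × V | c * ‖z.2‖ ≤ ⟪(z.1 : V), z.2⟫} :=
    (isClosed_le (by fun_prop) (by fun_prop)).measurableSet
  have hcap : ∀ y : V, y ≠ 0 → μ {x | c * ‖y‖ ≤ ⟪(x : V), y⟫} =
      μ {x | c ≤ ⟪(x : V), (p : V)⟫} := by
    intro y hy
    have hy0 : 0 < ‖y‖ := norm_pos_iff.2 hy
    obtain ⟨e, he⟩ := exists_sphereMap_eq p ⟨‖y‖⁻¹ • y, by simp [norm_smul, hy0.ne']⟩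
    have he' : y = ‖y‖ • e p := by
      have : e p = ‖y‖⁻¹ • y := congrArg Subtype.val he
      rw [this, smul_inv_smul₀ hy0.ne']
    have hm : MeasurableSet {x : Metric.sphere (0 : V) 1 | c * ‖y‖ ≤ ⟪(x : V), y⟫} :=
      (isClosed_le (by fun_prop) (by fun_prop)).measurableSet
    rw [← (hμ e).measure_preimage hm.nullMeasurableSet]
    congr 1
    ext x
    simp only [Set.mem_preimage, Set.mem_ofPred_eq, LinearIsometryEquiv.sphereMap]
    rw [he', inner_smul_right, e.inner_map_map, ← he', mul_comm, mul_le_mul_iff_right₀ hy0]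
  have hcone : ∀ x : Metric.sphere (0 : V) 1, ν {y | c * ‖y‖ ≤ ⟪(x : V), y⟫} =
      volume (Metric.ball (0 : V) 1 ∩ {y | c * ‖y‖ ≤ ⟪(q : V), y⟫}) := by
    intro x
    have hm (w : V) : MeasurableSet {y : V | c * ‖y‖ ≤ ⟪w, y⟫} :=
      (isClosed_le (by fun_prop) (by fun_prop)).measurableSet
    obtain ⟨e, he⟩ := exists_sphereMap_eq x q
    have he' : e x = q := congrArg Subtype.val he
    rw [hν, Measure.restrict_apply (hm x), Set.inter_comm,
      ← e.measurePreserving.measure_preimage (measurableSet_ball.inter (hm q)).nullMeasurableSet]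
    congr 1
    ext y
    simp [← he', e.inner_map_map]
  have h1 : (μ.prod ν) {z | c * ‖z.2‖ ≤ ⟪(z.1 : V), z.2⟫} =
      volume (Metric.ball (0 : V) 1 ∩ {y | c * ‖y‖ ≤ ⟪(q : V), y⟫}) := by
    rw [Measure.prod_apply hT]
    refine (lintegral_congr fun x => hcone x).trans ?_
    simp
  rw [← h1, Measure.prod_apply_symm hT]
  have hae : ∀ᵐ y ∂ν, μ ((fun x => (x, y)) ⁻¹'
      {z : Metric.sphere (0 : V) 1 × V | c * ‖z.2‖ ≤ ⟪(z.1 : V), z.2⟫}) =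
      μ {x | c ≤ ⟪(x : V), (p : V)⟫} := by
    refine ae_restrict_of_ae ?_
    filter_upwards [compl_mem_ae_iff.2 (measure_singleton (0 : V))] with y hy
    exact hcap y hy
  rw [lintegral_congr_ae hae]
  simp [hν]

lemma measure_cap_le {d : ℕ} (hd : d ≠ 0)
    {μ : Measure (Metric.sphere (0 : EuclideanSpace ℝ (Fin (d + 1))) 1)} [IsProbabilityMeasure μ]
    (hμ : ∀ e : EuclideanSpace ℝ (Fin (d + 1)) ≃ₗᵢ[ℝ] EuclideanSpace ℝ (Fin (d + 1)),
      MeasurePreserving e.sphereMap μ μ)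
    (p : Metric.sphere (0 : EuclideanSpace ℝ (Fin (d + 1))) 1) {t : ℝ} (h0 : 0 ≤ t)
    (ht : t ≤ Real.pi / 2) :
    μ {x | Real.sin t ≤ ⟪(x : EuclideanSpace ℝ (Fin (d + 1))), p⟫} ≤
      ENNReal.ofReal (Real.cos t ^ (d - 1)) := by
  have h := measure_cap_mul_volume_ball hμ p ⟨EuclideanSpace.single 0 1, by simp⟩ (Real.sin t)
  have h2 := h.trans_le (volume_cone_le d hd h0 ht)
  exact (ENNReal.mul_le_mul_iff_left (Metric.measure_ball_pos volume _ one_pos).ne'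
    measure_ball_lt_top.ne).1 h2

end CapMeasure

section Concentration

open scoped RealInnerProductSpace

lemma Real.cos_le_exp_neg_sq_half {t : ℝ} (h0 : 0 ≤ t) (ht : t ≤ Real.pi / 2) :
    Real.cos t ≤ Real.exp (-(t ^ 2 / 2)) := by
  have hder (x : ℝ) : HasDerivAt (fun x => Real.cos x * Real.exp (x ^ 2 / 2))
      (Real.exp (x ^ 2 / 2) * (x * Real.cos x - Real.sin x)) x := by
    have h1 : HasDerivAt (fun x : ℝ => x ^ 2 / 2) x x := by
      simpa using (hasDerivAt_pow 2 x).div_const 2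
    exact ((Real.hasDerivAt_cos x).mul h1.exp).congr_deriv (by ring)
  have hanti : AntitoneOn (fun x => Real.cos x * Real.exp (x ^ 2 / 2))
      (Set.Icc 0 (Real.pi / 2)) := by
    refine antitoneOn_of_deriv_nonpos (convex_Icc _ _) (by fun_prop)
      (fun x _ => (hder x).differentiableAt.differentiableWithinAt) fun x hx => ?_
    rw [interior_Icc] at hx
    rw [(hder x).deriv]
    have hcos : 0 < Real.cos x := Real.cos_pos_of_mem_Ioo ⟨by linarith [hx.1, Real.pi_pos], hx.2⟩
    have h := Real.lt_tan hx.1 hx.2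
    rw [Real.tan_eq_sin_div_cos, lt_div_iff₀ hcos] at h
    exact mul_nonpos_of_nonneg_of_nonpos (Real.exp_pos _).le (by linarith)
  have h := hanti ⟨le_rfl, h0.trans ht⟩ ⟨h0, ht⟩ h0
  simp only [Real.cos_zero, one_mul] at h
  norm_num at h
  rw [Real.exp_neg, ← one_div, le_div_iff₀ (Real.exp_pos _)]
  exact h

variable {V : Type*} [NormedAddCommGroup V] [InnerProductSpace ℝ V]

lemma inner_sphere_eq_cos_angle (x y : Metric.sphere (0 : V) 1) :
    ⟪(x : V), (y : V)⟫ = Real.cos (InnerProductGeometry.angle (x : V) y) :=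
  InnerProductGeometry.inner_eq_cos_angle_of_norm_eq_one (by simp) (by simp)

lemma exists_norm_eq_one_inner_eq_zero [FiniteDimensional ℝ V] (h : 2 ≤ Module.finrank ℝ V)
    (p : V) : ∃ w : V, ‖w‖ = 1 ∧ ⟪p, w⟫ = 0 := by
  have hne : (ℝ ∙ p)ᗮ ≠ ⊥ := by
    intro hbot
    have h1 := Submodule.finrank_add_finrank_orthogonal (ℝ ∙ p)
    rw [hbot, finrank_bot] at h1
    have h2 := finrank_span_le_card (R := ℝ) {p}
    rw [Set.toFinset_singleton, Finset.card_singleton] at h2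
    omega
  obtain ⟨w, hw, hw0⟩ := Submodule.exists_mem_ne_zero_of_ne_bot hne
  refine ⟨‖w‖⁻¹ • w, by simp [norm_smul, hw0], ?_⟩
  rw [inner_smul_right, Submodule.mem_orthogonal_singleton_iff_inner_right.1 hw, mul_zero]

/-- A point of the great circle through `p` and `x` at distance `α` from `p`. -/
lemma exists_sphere_inner_eq [FiniteDimensional ℝ V] (h : 2 ≤ Module.finrank ℝ V)
    (x p : Metric.sphere (0 : V) 1) (α : ℝ) :
    ∃ y : Metric.sphere (0 : V) 1, ⟪(y : V), (p : V)⟫ = Real.cos α ∧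
      ⟪(y : V), (x : V)⟫ = Real.cos (InnerProductGeometry.angle (x : V) p - α) := by
  set θ := InnerProductGeometry.angle (x : V) p with hθ
  have hxp : ⟪(p : V), (x : V)⟫ = Real.cos θ := by
    rw [real_inner_comm, inner_sphere_eq_cos_angle]
  have hp : ⟪(p : V), (p : V)⟫ = 1 := by simp
  have hsq := Real.sin_sq_add_cos_sq θ
  obtain ⟨w, hw1, hwp, hx⟩ : ∃ w : V, ‖w‖ = 1 ∧ ⟪(p : V), w⟫ = 0 ∧
      (x : V) = Real.cos θ • (p : V) + Real.sin θ • w := by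
    have hn : ‖(x : V) - Real.cos θ • (p : V)‖ ^ 2 = Real.sin θ ^ 2 := by
      rw [norm_sub_sq_real, inner_smul_right, real_inner_comm, hxp, norm_smul]
      simp
      linarith
    by_cases hs : Real.sin θ = 0
    · obtain ⟨w, hw1, hwp⟩ := exists_norm_eq_one_inner_eq_zero h (p : V)
      refine ⟨w, hw1, hwp, ?_⟩
      rw [hs, zero_pow two_ne_zero, sq_eq_zero_iff, norm_eq_zero] at hn
      rw [hs, zero_smul, add_zero]
      exact sub_eq_zero.1 hn
    · refine ⟨(Real.sin θ)⁻¹ • ((x : V) - Real.cos θ • (p : V)), ?_, ?_, ?_⟩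
      · rw [← sq_eq_sq₀ (norm_nonneg _) zero_le_one, norm_smul, mul_pow, hn]
        simp [hs]
      · rw [inner_smul_right, inner_sub_right, inner_smul_right, hxp, hp]
        ring
      · rw [smul_inv_smul₀ hs]
        abel
  have hww : ⟪w, w⟫ = 1 := by simp [hw1]
  have hpw : ⟪w, (p : V)⟫ = 0 := by rw [real_inner_comm, hwp]
  refine ⟨⟨Real.cos α • (p : V) + Real.sin α • w, ?_⟩, ?_, ?_⟩
  · rw [mem_sphere_zero_iff_norm, ← sq_eq_sq₀ (norm_nonneg _) zero_le_one,
      ← real_inner_self_eq_norm_sq]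
    simp only [inner_add_left, inner_add_right, real_inner_smul_left, inner_smul_right, hp, hww,
      hpw, hwp]
    linarith [Real.sin_sq_add_cos_sq α]
  · simp only [inner_add_left, real_inner_smul_left, hp, hpw]
    ring
  · rw [hx]
    simp only [inner_add_left, inner_add_right, real_inner_smul_left, inner_smul_right, hp, hww,
      hpw, hwp, Real.cos_sub]
    ring

/-- A point far from a cap is in the opposite cap. -/
lemma le_angle_of_notMem_thickening_cap [FiniteDimensional ℝ V] (h : 2 ≤ Module.finrank ℝ V)
    {ρ ε : ℝ} (hε : 0 < ε) (hε2 : ε < Real.pi / 2) (hερ : ε < ρ) (hρ : ρ ≤ Real.pi)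
    (x p : Metric.sphere (0 : V) 1)
    (hx : x ∉ Metric.thickening √(2 - 2 * Real.cos ρ)
      {x : Metric.sphere (0 : V) 1 | Real.sin ε < ⟪(x : V), (p : V)⟫}) :
    Real.pi / 2 + (ρ - ε) ≤ InnerProductGeometry.angle (x : V) p := by
  by_contra! hlt
  set θ := InnerProductGeometry.angle (x : V) p with hθ
  have hθ0 : 0 ≤ θ := InnerProductGeometry.angle_nonneg _ _
  have hθπ : θ ≤ Real.pi := InnerProductGeometry.angle_le_pi _ _
  obtain ⟨β, hβ0, hβρ, hβθ, hβ⟩ : ∃ β, 0 ≤ β ∧ β < ρ ∧ β ≤ θ ∧ θ - β < Real.pi / 2 - ε := by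
    by_cases h1 : θ < Real.pi / 2 - ε
    · exact ⟨0, le_rfl, hε.trans hερ, hθ0, by linarith⟩
    · obtain ⟨β, hβ1, hβ2⟩ := exists_between
        (show θ - Real.pi / 2 + ε < min ρ θ from lt_min (by linarith) (by linarith))
      rw [lt_min_iff] at hβ2
      exact ⟨β, by linarith, hβ2.1, hβ2.2.le, by linarith⟩
  obtain ⟨y, hyp, hyx⟩ := exists_sphere_inner_eq h x p (θ - β)
  refine hx (Metric.mem_thickening_iff.2 ⟨y, ?_, ?_⟩)
  · rw [Set.mem_ofPred_eq, hyp, ← Real.cos_pi_div_two_sub]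
    exact Real.cos_lt_cos_of_nonneg_of_le_pi (by linarith) (by linarith) hβ
  · refine Real.lt_sqrt_of_sq_lt ?_
    rw [dist_sphere_sq, real_inner_comm, hyx, ← hθ, sub_sub_cancel]
    have := Real.cos_lt_cos_of_nonneg_of_le_pi hβ0 hρ hβρ
    linarith

lemma measure_le_exp_of_le_angle {d : ℕ} (hd : d ≠ 0)
    {μ : Measure (Metric.sphere (0 : EuclideanSpace ℝ (Fin (d + 1))) 1)} [IsProbabilityMeasure μ]
    (hμ : ∀ e : EuclideanSpace ℝ (Fin (d + 1)) ≃ₗᵢ[ℝ] EuclideanSpace ℝ (Fin (d + 1)),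
      MeasurePreserving e.sphereMap μ μ)
    {A B : Set (Metric.sphere (0 : EuclideanSpace ℝ (Fin (d + 1))) 1)} (hA : 1 / 2 ≤ μ A)
    {ρ : ℝ} (hρ : 0 < ρ)
    (hAB : ∀ x ∈ A, ∀ y ∈ B,
      ρ ≤ InnerProductGeometry.angle (x : EuclideanSpace ℝ (Fin (d + 1))) y) :
    μ B ≤ ENNReal.ofReal (Real.exp (-((d : ℝ) - 1) * ρ ^ 2 / 2)) := by
  obtain ⟨p, hp⟩ : A.Nonempty := by
    refine nonempty_of_measure_ne_zero (μ := μ) fun h0 => ?_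
    simp [h0] at hA
  rcases B.eq_empty_or_nonempty with rfl | ⟨b, hb⟩
  · simp
  have hρπ : ρ ≤ Real.pi := (hAB p hp b hb).trans (InnerProductGeometry.angle_le_pi _ _)
  have hfin : 2 ≤ Module.finrank ℝ (EuclideanSpace ℝ (Fin (d + 1))) := by
    rw [finrank_euclideanSpace_fin]
    omega
  set δ := √(2 - 2 * Real.cos ρ) with hδ
  have hB : B ⊆ (Metric.thickening δ (closure A))ᶜ := by
    rw [Metric.thickening_closure]
    intro y hy hmem
    obtain ⟨x, hx, hyx⟩ := Metric.mem_thickening_iff.1 hmem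
    rw [hδ, Real.lt_sqrt dist_nonneg, dist_comm, dist_sphere_sq, inner_sphere_eq_cos_angle] at hyx
    have := Real.cos_le_cos_of_nonneg_of_le_pi hρ.le (InnerProductGeometry.angle_le_pi _ _)
      (hAB x hx y hy)
    linarith
  have hbound (ε : ℝ) (hε : 0 < ε) (hε2 : ε < Real.pi / 2) (hερ : ε < ρ) :
      μ B ≤ ENNReal.ofReal (Real.exp (-((d : ℝ) - 1) * (ρ - ε) ^ 2 / 2)) := by
    have hcap := measure_thickening_cap_le hμ isClosed_closure
      (hA.trans (measure_mono subset_closure)) p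
      (Real.sin_pos_of_pos_of_lt_pi hε (by linarith)) δ
    have h1 : μ B ≤ μ (Metric.thickening δ
        {x | Real.sin ε < ⟪(x : EuclideanSpace ℝ (Fin (d + 1))), p⟫})ᶜ := by
      refine (measure_mono hB).trans ?_
      rw [prob_compl_eq_one_sub Metric.isOpen_thickening.measurableSet,
        prob_compl_eq_one_sub Metric.isOpen_thickening.measurableSet]
      exact tsub_le_tsub_left hcap 1
    refine h1.trans ?_
    rcases le_or_gt (ρ - ε) (Real.pi / 2) with ht | ht
    · refine (measure_mono fun x hx => ?_).trans
        ((measure_cap_le hd hμ (-p) (sub_nonneg.2 hερ.le) ht).trans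
        (ENNReal.ofReal_le_ofReal ?_))
      · have hθ := le_angle_of_notMem_thickening_cap hfin hε hε2 hερ hρπ x p hx
        have hcos := Real.cos_le_cos_of_nonneg_of_le_pi (by linarith [Real.pi_pos])
          (InnerProductGeometry.angle_le_pi _ _) hθ
        rw [← inner_sphere_eq_cos_angle, Real.cos_add, Real.cos_pi_div_two,
          Real.sin_pi_div_two] at hcos
        rw [Set.mem_ofPred_eq, coe_neg_sphere, inner_neg_right]
        linarith
      · refine (pow_le_pow_left₀ (Real.cos_nonneg_of_mem_Icc ⟨by linarith, ht⟩)
          (Real.cos_le_exp_neg_sq_half (sub_nonneg.2 hερ.le) ht) (d - 1)).trans_eq ?_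
        rw [← Real.exp_nat_mul, Nat.cast_sub (Nat.one_le_iff_ne_zero.2 hd)]
        congr 1
        push_cast
        ring
    · refine (measure_mono_null (fun x hx => ?_) measure_empty).le.trans zero_le
      have hθ := le_angle_of_notMem_thickening_cap hfin hε hε2 hερ hρπ x p hx
      linarith [InnerProductGeometry.angle_le_pi (x : EuclideanSpace ℝ (Fin (d + 1))) p]
  have hlim : Filter.Tendsto
      (fun ε : ℝ => ENNReal.ofReal (Real.exp (-((d : ℝ) - 1) * (ρ - ε) ^ 2 / 2)))
      (nhdsWithin 0 (Set.Ioi 0))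
      (nhds (ENNReal.ofReal (Real.exp (-((d : ℝ) - 1) * ρ ^ 2 / 2)))) := by
    have hc : Continuous
        (fun ε : ℝ => ENNReal.ofReal (Real.exp (-((d : ℝ) - 1) * (ρ - ε) ^ 2 / 2))) :=
      ENNReal.continuous_ofReal.comp (by fun_prop)
    simpa using (hc.tendsto 0).mono_left nhdsWithin_le_nhds
  refine ge_of_tendsto hlim ?_
  filter_upwards [Ioo_mem_nhdsGT (lt_min Real.pi_div_two_pos hρ)] with ε hε
  exact hbound ε hε.1 (hε.2.trans_le (min_le_left _ _)) (hε.2.trans_le (min_le_right _ _))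

end Concentration

lemma measurePreserving_sphereMap_comap {V : Type*} [NormedAddCommGroup V] [InnerProductSpace ℝ V]
    [MeasurableSpace V] [BorelSpace V] {σ : Measure V} (e : V ≃ₗᵢ[ℝ] V) (he : σ.map e = σ) :
    MeasurePreserving e.sphereMap (σ.comap ((↑) : Metric.sphere (0 : V) 1 → V))
      (σ.comap ((↑) : Metric.sphere (0 : V) 1 → V)) := by
  have hemb := MeasurableEmbedding.subtype_coe
    (Metric.isClosed_sphere (x := (0 : V)) (ε := 1)).measurableSet
  have hm : Measurable e.sphereMap := e.isometry_sphereMap.continuous.measurable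
  refine ⟨hm, Measure.ext fun S hS => ?_⟩
  rw [Measure.map_apply hm hS, hemb.comap_apply, hemb.comap_apply]
  nth_rewrite 2 [← he]
  rw [Measure.map_apply e.continuous.measurable (hemb.measurableSet_image.2 hS)]
  congr 1
  ext x
  simp [LinearIsometryEquiv.sphereMap]

/-- Lévy concentration of measure on the sphere: if `f` is `L`-Lipschitz on the unit
sphere `S^d ⊂ ℝ^{d+1}` with respect to the geodesic (round) distance, `σ` is the uniform
probability measure on the sphere, and `M` is a median of `f`, then
`σ(|f − M| ≥ r) ≤ 2 exp(−(d−1)r²/(2L²))`. -/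
theorem levy_concentration_on_sphere
    (d : ℕ) (hd : 2 ≤ d)
    (σ : Measure (EuclideanSpace ℝ (Fin (d + 1)))) [IsProbabilityMeasure σ]
    (hsphere : σ (Metric.sphere (0 : EuclideanSpace ℝ (Fin (d + 1))) 1) = 1)
    (hinv : ∀ e : EuclideanSpace ℝ (Fin (d + 1)) ≃ₗᵢ[ℝ] EuclideanSpace ℝ (Fin (d + 1)),
      σ.map e = σ)
    (f : EuclideanSpace ℝ (Fin (d + 1)) → ℝ) (L : ℝ) (hL : 0 < L)
    -- `f` is Lipschitz with constant `L` w.r.t. the geodesic distance on the sphere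
    (hlip : ∀ x ∈ Metric.sphere (0 : EuclideanSpace ℝ (Fin (d + 1))) 1,
      ∀ y ∈ Metric.sphere (0 : EuclideanSpace ℝ (Fin (d + 1))) 1,
        |f x - f y| ≤ L * InnerProductGeometry.angle x y)
    -- `M` is a median of `f` for `σ`
    (M : ℝ) (hM₁ : 1 / 2 ≤ σ {x | f x ≤ M}) (hM₂ : 1 / 2 ≤ σ {x | M ≤ f x})
    (r : ℝ) (hr : 0 < r) :
    σ {x ∈ Metric.sphere (0 : EuclideanSpace ℝ (Fin (d + 1))) 1 | r ≤ |f x - M|} ≤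
      ENNReal.ofReal (2 * Real.exp (-((d : ℝ) - 1) * r ^ 2 / (2 * L ^ 2))) := by

  have hemb := MeasurableEmbedding.subtype_coe
    (Metric.isClosed_sphere (x := (0 : EuclideanSpace ℝ (Fin (d + 1)))) (ε := 1)).measurableSet
  set μ := σ.comap ((↑) : Metric.sphere (0 : EuclideanSpace ℝ (Fin (d + 1))) 1 →
    EuclideanSpace ℝ (Fin (d + 1))) with hμ
  have hprob : IsProbabilityMeasure μ := ⟨by
    rw [hμ, hemb.comap_apply, Set.image_univ, Subtype.range_coe, hsphere]⟩
  have hpre (S : Set (EuclideanSpace ℝ (Fin (d + 1)))) : μ (Subtype.val ⁻¹' S) = σ S := by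
    rw [hμ, hemb.comap_apply, Subtype.image_preimage_coe, Set.inter_comm]
    refine measure_inter_conull' ?_
    refine measure_mono_null (Set.sdiff_subset_compl _ _) ?_
    exact (prob_compl_eq_zero_iff Metric.isClosed_sphere.measurableSet).2 hsphere
  have hmp := fun e => measurePreserving_sphereMap_comap e (hinv e)
  have key (A B : Set (EuclideanSpace ℝ (Fin (d + 1)))) (hA : 1 / 2 ≤ σ A)
      (hAB : ∀ x ∈ A, ∀ y ∈ B, r ≤ |f x - f y|) :
      σ B ≤ ENNReal.ofReal (Real.exp (-((d : ℝ) - 1) * (r / L) ^ 2 / 2)) := by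
    rw [← hpre] at hA ⊢
    refine measure_le_exp_of_le_angle (by omega) hmp hA (div_pos hr hL) fun x hx y hy => ?_
    rw [div_le_iff₀' hL]
    exact (hAB x hx y hy).trans (hlip x x.2 y y.2)
  have hsub : {x ∈ Metric.sphere (0 : EuclideanSpace ℝ (Fin (d + 1))) 1 | r ≤ |f x - M|} ⊆
      {x | M + r ≤ f x} ∪ {x | f x ≤ M - r} := by
    rintro x ⟨-, hx⟩
    rcases le_abs.1 hx with h | h
    · exact Or.inl (by simp only [Set.mem_ofPred_eq]; linarith)
    · exact Or.inr (by simp only [Set.mem_ofPred_eq]; linarith)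
  have h1 := key {x | f x ≤ M} {x | M + r ≤ f x} hM₁ fun x hx y hy => by
    simp only [Set.mem_ofPred_eq] at hx hy
    exact le_abs.2 (Or.inr (by linarith))
  have h2 := key {x | M ≤ f x} {x | f x ≤ M - r} hM₂ fun x hx y hy => by
    simp only [Set.mem_ofPred_eq] at hx hy
    exact le_abs.2 (Or.inl (by linarith))
  have hexp : -((d : ℝ) - 1) * r ^ 2 / (2 * L ^ 2) = -((d : ℝ) - 1) * (r / L) ^ 2 / 2 := by
    field_simp
  calc _ ≤ _ := (measure_mono hsub).trans ((measure_union_le _ _).trans (add_le_add h1 h2))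
    _ = _ := by
      rw [← ENNReal.ofReal_add (Real.exp_pos _).le (Real.exp_pos _).le, ← two_mul, hexp]
end

section
/- Let m ≥ 0 and n ≥ 0 be integers, let P_n be the complex vector space of homogeneous holomorphic polynomials of degree n on ℂ^{m+1} (its dimension is d_n = binom(n+m, m)), equipped with the inner product ⟨f, g⟩ = ∫_{S^{2m+1}} f · conj(g) dμ, where μ is the uniform probability measure on the unit sphere S^{2m+1} ⊂ ℂ^{m+1}. Then for any orthonormal basis {s_1, …, s_{d_n}} of P_n and all x, y ∈ S^{2m+1}, Σ_{j=1}^{d_n} s_j(x) · conj(s_j(y)) = binom(n+m, m) · (Σ_{i=0}^{m} x_i · conj(y_i))^n. -/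
open MeasureTheory MvPolynomial

open scoped ComplexConjugate InnerProductSpace

/-- A continuous function is integrable for a probability measure carried by the unit sphere. -/
lemma Continuous.integrable_of_measure_sphere_eq_one {E : Type*} [NormedAddCommGroup E]
    [ProperSpace E] [MeasurableSpace E] [BorelSpace E] {μ : Measure E}
    [IsProbabilityMeasure μ] (hsphere : μ (Metric.sphere (0 : E) 1) = 1) {f : E → ℂ}
    (hf : Continuous f) : Integrable f μ := by
  have hae : ∀ᵐ x ∂μ, x ∈ Metric.sphere (0 : E) 1 :=
    (mem_ae_iff_prob_eq_one Metric.isClosed_sphere.measurableSet).2 hsphere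
  rw [← Measure.restrict_eq_self_of_ae_mem hae]
  exact hf.continuousOn.integrableOn_compact (isCompact_sphere 0 1)

/-- If a measure-preserving map acts linearly on an orthonormal family, then it preserves the
kernel of the family. -/
lemma sum_mul_conj_comp_eq_of_orthonormal {E ι : Type*} [Fintype ι] [DecidableEq ι]
    [MeasurableSpace E] {μ : Measure E} {s : ι → E → ℂ} {φ : E → E}
    (hφ : MeasurePreserving φ μ μ)
    (hint : ∀ j k, Integrable (fun x => s j x * conj (s k x)) μ)
    (horth : ∀ j k, ∫ x, s j x * conj (s k x) ∂μ = if j = k then 1 else 0)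
    (A : Matrix ι ι ℂ) (hA : ∀ k x, s k (φ x) = ∑ j, A k j * s j x) (x y : E) :
    ∑ k, s k (φ x) * conj (s k (φ y)) = ∑ k, s k x * conj (s k y) := by
  have expand : ∀ k l x y, s k (φ x) * conj (s l (φ y)) =
      ∑ i, ∑ j, A k i * conj (A l j) * (s i x * conj (s j y)) := by
    intro k l x y
    rw [hA, hA, map_sum, Finset.sum_mul_sum]
    refine Finset.sum_congr rfl fun i _ => Finset.sum_congr rfl fun j _ => ?_
    rw [map_mul]
    ring
  have hmul : A * A.conjTranspose = 1 := by
    ext k l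
    have hcomp : ∫ x, s k (φ x) * conj (s l (φ x)) ∂μ = ∫ x, s k x * conj (s l x) ∂μ := by
      conv_rhs => rw [← hφ.map_eq]
      refine (integral_map (f := fun x => s k x * conj (s l x)) hφ.aemeasurable ?_).symm
      rw [hφ.map_eq]
      exact (hint k l).aestronglyMeasurable
    rw [horth] at hcomp
    rw [Matrix.one_apply, ← hcomp, Matrix.mul_apply]
    simp_rw [expand]
    rw [integral_finsetSum _ fun i _ =>
      integrable_finsetSum _ fun j _ => (hint i j).const_mul _]
    refine Finset.sum_congr rfl fun i _ => ?_
    rw [integral_finsetSum _ fun j _ => (hint i j).const_mul _]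
    simp_rw [integral_const_mul, horth]
    simp [Matrix.conjTranspose_apply]
  have hmul' : ∀ i j, ∑ k, A k i * conj (A k j) = if i = j then 1 else 0 := by
    intro i j
    have hmul_comm : A.conjTranspose * A = 1 := mul_eq_one_comm.1 hmul
    have h := congrFun (congrFun hmul_comm j) i
    rw [Matrix.mul_apply, Matrix.one_apply] at h
    simp_rw [Matrix.conjTranspose_apply] at h
    simp_rw [eq_comm (a := i), ← h, mul_comm (A _ i)]
    rfl
  simp_rw [expand]
  rw [Finset.sum_comm]
  refine Finset.sum_congr rfl fun i _ => ?_
  rw [Finset.sum_comm]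
  simp_rw [← Finset.sum_mul, hmul']
  simp

/-- The map fixing the unit vector `y` and multiplying its orthogonal complement by the unit
scalar `c`, as a real-linear isometric equivalence. -/
lemma exists_linearIsometryEquiv_smul_orthogonal {E : Type*} [NormedAddCommGroup E]
    [InnerProductSpace ℂ E] [FiniteDimensional ℂ E] {y : E} (hy : ‖y‖ = 1) {c : ℂ}
    (hc : ‖c‖ = 1) :
    ∃ e : E ≃ₗᵢ[ℝ] E, ∀ x, e x = c • x + ((1 - c) * ⟪y, x⟫_ℂ) • y := by
  let L : E →ₗ[ℂ] E := c • LinearMap.id + (1 - c) • (innerₛₗ ℂ y).smulRight y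
  have hL : ∀ x, L x = c • x + ((1 - c) * ⟪y, x⟫_ℂ) • y := fun x => by simp [L, mul_smul]
  have hnorm : ∀ x, ‖L x‖ = ‖x‖ := by
    intro x
    have hyy : ⟪y, y⟫_ℂ = 1 := by simp [inner_self_eq_norm_sq_to_K, hy]
    have hcc : conj c * c = 1 := by rw [mul_comm, Complex.mul_conj']; simp [hc]
    have h : ⟪L x, L x⟫_ℂ = ⟪x, x⟫_ℂ := by
      rw [hL]
      simp only [inner_add_left, inner_add_right, inner_smul_left, inner_smul_right, hyy,
        map_mul, map_sub, map_one, inner_conj_symm]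
      linear_combination (⟪x, x⟫_ℂ - ⟪y, x⟫_ℂ * ⟪x, y⟫_ℂ) * hcc
    rw [inner_self_eq_norm_sq_to_K, inner_self_eq_norm_sq_to_K] at h
    exact (sq_eq_sq₀ (norm_nonneg _) (norm_nonneg _)).1 (by exact_mod_cast h)
  have : FiniteDimensional ℝ E := FiniteDimensional.complexToReal E
  let T : E →ₗᵢ[ℝ] E := ⟨L.restrictScalars ℝ, hnorm⟩
  exact ⟨T.toLinearIsometryEquiv rfl, hL⟩

/-- A homogeneous polynomial scales by the `n`-th power of the scalar. -/
lemma MvPolynomial.IsHomogeneous.eval_mul {σ : Type*} {p : MvPolynomial σ ℂ} {n : ℕ}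
    (hp : p.IsHomogeneous n) (a : ℂ) (v : σ → ℂ) :
    eval (fun i => a * v i) p = a ^ n * eval v p := by
  rw [eval_eq, eval_eq, Finset.mul_sum]
  refine Finset.sum_congr rfl fun d hd => ?_
  have hdeg : ∑ i ∈ d.support, d i = n :=
    (hp.degree_eq_sum_deg_support hd).symm
  rw [← hdeg, ← Finset.prod_pow_eq_pow_sum]
  simp_rw [mul_pow]
  rw [Finset.prod_mul_distrib]
  ring

/-- If a linear combination of polynomials, restricted to the line `v + c w`, is constant on the
unit circle `‖c‖ = 1`, then it takes the same value at `c = 0`. -/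
lemma MvPolynomial.eval_add_eq_of_unit_circle {σ ι : Type*} [Fintype ι]
    (p : ι → MvPolynomial σ ℂ) (b : ι → ℂ) (v w : σ → ℂ)
    (h : ∀ c : ℂ, ‖c‖ = 1 → ∑ k, eval (fun i => v i + c * w i) (p k) * b k =
      ∑ k, eval (fun i => v i + w i) (p k) * b k) :
    ∑ k, eval v (p k) * b k = ∑ k, eval (fun i => v i + w i) (p k) * b k := by
  let q : Polynomial ℂ := ∑ k, aeval (fun i => Polynomial.C (v i) + Polynomial.X *
    Polynomial.C (w i)) (p k) * Polynomial.C (b k)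
  have hq : ∀ c, q.eval c = ∑ k, eval (fun i => v i + c * w i) (p k) * b k := by
    intro c
    simp only [q, Polynomial.eval_finsetSum, Polynomial.eval_mul, Polynomial.eval_C]
    refine Finset.sum_congr rfl fun k _ => ?_
    congr 1
    have := congrArg (fun f => f (p k)) (comp_aeval (R := ℂ)
      (fun i => Polynomial.C (v i) + Polynomial.X * Polynomial.C (w i)) (Polynomial.aeval c))
    simpa [aeval_eq_eval, mul_comm c] using this
  have hinf : (Metric.sphere (0 : ℂ) 1).Infinite := by
    refine (isPreconnected_sphere (by simp) (0 : ℂ) 1).infinite_of_nontrivial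
      ⟨1, by simp, -1, by simp, ?_⟩
    norm_num
  have hqc : q = Polynomial.C (∑ k, eval (fun i => v i + w i) (p k) * b k) := by
    refine Polynomial.eq_of_infinite_eval_eq _ _ (hinf.mono fun c hc => ?_)
    have hc' : ‖c‖ = 1 := by simpa using hc
    rw [Set.mem_ofPred_eq, hq, h c hc', Polynomial.eval_C]
  have h0 := hq 0
  rw [hqc, Polynomial.eval_C] at h0
  simpa using h0.symm

/-- Polynomials are square-integrable for a probability measure carried by the unit sphere. -/
lemma integrable_eval_mul_conj_eval {σ : Type*} [Fintype σ]
    [MeasurableSpace (EuclideanSpace ℂ σ)] [BorelSpace (EuclideanSpace ℂ σ)]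
    {μ : Measure (EuclideanSpace ℂ σ)} [IsProbabilityMeasure μ]
    (hsphere : μ (Metric.sphere (0 : EuclideanSpace ℂ σ) 1) = 1) (p q : MvPolynomial σ ℂ) :
    Integrable (fun x => eval (fun i => x i) p * conj (eval (fun i => x i) q)) μ := by
  have hcont : ∀ p : MvPolynomial σ ℂ,
      Continuous fun x : EuclideanSpace ℂ σ => eval (fun i => x i) p := fun p =>
    p.continuous_eval.comp (by fun_prop)
  exact ((hcont p).mul
    (Complex.continuous_conj.comp (hcont q))).integrable_of_measure_sphere_eq_one hsphere

section UnitSphereKernel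

variable {m n : ℕ} {ι : Type*} [Fintype ι] [DecidableEq ι]
  [MeasurableSpace (EuclideanSpace ℂ (Fin (m + 1)))]
  [BorelSpace (EuclideanSpace ℂ (Fin (m + 1)))]
  {μ : Measure (EuclideanSpace ℂ (Fin (m + 1)))} [IsProbabilityMeasure μ]
  {s : ι → MvPolynomial (Fin (m + 1)) ℂ}

/-- The kernel of an orthonormal basis of homogeneous polynomials, for a rotation-invariant
measure on the unit sphere, is determined by its diagonal. -/
lemma sum_eval_mul_conj_eval_eq_inner_pow_mul
    (hsphere : μ (Metric.sphere (0 : EuclideanSpace ℂ (Fin (m + 1))) 1) = 1)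
    (hinv : ∀ e : EuclideanSpace ℂ (Fin (m + 1)) ≃ₗᵢ[ℝ] EuclideanSpace ℂ (Fin (m + 1)),
      μ.map e = μ)
    (hhom : ∀ j, s j ∈ homogeneousSubmodule (Fin (m + 1)) ℂ n)
    (horth : ∀ j k, ∫ x, eval (fun i => x i) (s j) * conj (eval (fun i => x i) (s k)) ∂μ =
      if j = k then 1 else 0)
    (hspan : ∀ f ∈ homogeneousSubmodule (Fin (m + 1)) ℂ n,
      f ∈ Submodule.span ℂ (Set.range s))
    (x : EuclideanSpace ℂ (Fin (m + 1))) {y : EuclideanSpace ℂ (Fin (m + 1))} (hy : ‖y‖ = 1) :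
    ∑ j, eval (fun i => x i) (s j) * conj (eval (fun i => y i) (s j)) =
      ⟪y, x⟫_ℂ ^ n * ∑ j, eval (fun i => y i) (s j) * conj (eval (fun i => y i) (s j)) := by
  have hyy : ⟪y, y⟫_ℂ = 1 := by simp [inner_self_eq_norm_sq_to_K, hy]
  have hrot : ∀ c : ℂ, ‖c‖ = 1 →
      ∑ j, eval (fun i => ⟪y, x⟫_ℂ * y i + c * (x i - ⟪y, x⟫_ℂ * y i)) (s j) *
        conj (eval (fun i => y i) (s j)) =
      ∑ j, eval (fun i => x i) (s j) * conj (eval (fun i => y i) (s j)) := by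
    intro c hc
    obtain ⟨e, he⟩ := exists_linearIsometryEquiv_smul_orthogonal hy hc
    let l : Fin (m + 1) → MvPolynomial (Fin (m + 1)) ℂ := fun i =>
      C c * X i + C ((1 - c) * y i) * ∑ j, C (conj (y j)) * X j
    have hl : ∀ i, (l i).IsHomogeneous 1 := by
      intro i
      refine ((isHomogeneous_X ℂ i).C_mul c).add
        (IsHomogeneous.C_mul (IsHomogeneous.sum _ _ _ fun j _ => ?_) _)
      exact (isHomogeneous_X ℂ j).C_mul _
    have hle : ∀ p (z : EuclideanSpace ℂ (Fin (m + 1))),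
        eval (fun i => z i) (aeval l p) = eval (fun i => e z i) p := by
      intro p z
      have h := congrArg (fun f => f p) (comp_aeval (R := ℂ) l (aeval fun i => z i))
      have hz : (fun i => aeval (fun i => z i) (l i)) = fun i => e z i := by
        funext i
        simp [l, he, PiLp.inner_apply, aeval_eq_eval]
        simp_rw [mul_comm (z _)]
        ring
      simp only [hz] at h
      simpa [aeval_eq_eval] using h
    have hex : ∀ k, ∃ a : ι → ℂ, ∑ j, a j • s j = aeval l (s k) := fun k =>
      (Submodule.mem_span_range_iff_exists_fun ℂ).1 (hspan _ (by
        simpa using IsHomogeneous.aeval (hhom k) l hl))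
    choose A hA using hex
    have hK := sum_mul_conj_comp_eq_of_orthonormal
      (s := fun j (z : EuclideanSpace ℂ (Fin (m + 1))) => eval (fun i => z i) (s j))
      (φ := e) ⟨e.continuous.measurable, hinv e⟩
      (fun j k => integrable_eval_mul_conj_eval hsphere (s j) (s k))
      horth (Matrix.of A) (fun k z => by
        rw [← hle, ← hA, map_sum]
        simp [smul_eval]) x y
    have hey : e y = y := by
      rw [he, hyy, ← add_smul]
      simp
    have hex' : (fun i => e x i) =
        fun i => ⟪y, x⟫_ℂ * y i + c * (x i - ⟪y, x⟫_ℂ * y i) := by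
      funext i
      simp only [he, PiLp.add_apply, PiLp.smul_apply, smul_eq_mul]
      ring
    simpa only [hey, hex'] using hK
  have h := eval_add_eq_of_unit_circle s (fun j => conj (eval (fun i => y i) (s j)))
    (fun i => ⟪y, x⟫_ℂ * y i) (fun i => x i - ⟪y, x⟫_ℂ * y i) (fun c hc => by
      simpa using hrot c hc)
  simp only [add_sub_cancel] at h
  rw [← h, Finset.mul_sum]
  refine Finset.sum_congr rfl fun j _ => ?_
  rw [IsHomogeneous.eval_mul (hhom j), mul_assoc]

end UnitSphereKernel

/-- The Szegő kernel of the space `P_n` of homogeneous holomorphic polynomials of degree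
`n` on `ℂ^{m+1}`, with the inner product `⟨f,g⟩ = ∫_{S^{2m+1}} f conj(g) dμ` given by
the uniform probability measure `μ` on the unit sphere: for any orthonormal basis
`s₁, …, s_{d_n}` of `P_n` (`d_n = binom(n+m,m)`) and `x, y` on the sphere,
`Σⱼ sⱼ(x) conj(sⱼ(y)) = binom(n+m,m) (Σᵢ xᵢ conj(yᵢ))^n`. -/
theorem szego_kernel_sphere
    (m n : ℕ)
    [MeasurableSpace (EuclideanSpace ℂ (Fin (m + 1)))]
    [BorelSpace (EuclideanSpace ℂ (Fin (m + 1)))]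
    (μ : Measure (EuclideanSpace ℂ (Fin (m + 1)))) [IsProbabilityMeasure μ]
    (hsphere : μ (Metric.sphere (0 : EuclideanSpace ℂ (Fin (m + 1))) 1) = 1)
    (hinv : ∀ e : EuclideanSpace ℂ (Fin (m + 1)) ≃ₗᵢ[ℝ] EuclideanSpace ℂ (Fin (m + 1)),
      μ.map e = μ)
    (s : Fin ((n + m).choose m) → MvPolynomial (Fin (m + 1)) ℂ)
    -- each `sⱼ` is homogeneous of degree `n`
    (hhom : ∀ j, s j ∈ homogeneousSubmodule (Fin (m + 1)) ℂ n)
    -- the family is orthonormal for the inner product `⟨f,g⟩ = ∫ f conj(g) dμ`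
    (horth : ∀ j k, ∫ x, eval (fun i => x i) (s j) *
        (starRingEnd ℂ) (eval (fun i => x i) (s k)) ∂μ =
      if j = k then 1 else 0)
    -- and it spans `P_n`, i.e. it is an orthonormal basis of `P_n`
    (hspan : ∀ f ∈ homogeneousSubmodule (Fin (m + 1)) ℂ n,
      f ∈ Submodule.span ℂ (Set.range s))
    (x y : EuclideanSpace ℂ (Fin (m + 1))) (hx : ‖x‖ = 1) (hy : ‖y‖ = 1) :
    ∑ j, eval (fun i => x i) (s j) * (starRingEnd ℂ) (eval (fun i => y i) (s j)) =
      ((n + m).choose m : ℂ) * (∑ i, x i * (starRingEnd ℂ) (y i)) ^ n := by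
  let K : EuclideanSpace ℂ (Fin (m + 1)) → EuclideanSpace ℂ (Fin (m + 1)) → ℂ := fun x y =>
    ∑ j, eval (fun i => x i) (s j) * conj (eval (fun i => y i) (s j))
  have hK : ∀ x y, ‖y‖ = 1 → K x y = ⟪y, x⟫_ℂ ^ n * K y y := fun x _ hy =>
    sum_eval_mul_conj_eval_eq_inner_pow_mul hsphere hinv hhom horth hspan x hy
  have hKconj : ∀ x y, conj (K x y) = K y x := by
    intro x y
    simp [K, mul_comm]
  have hdiag_of_inner_ne : ∀ x y, ‖x‖ = 1 → ‖y‖ = 1 → ⟪y, x⟫_ℂ ≠ 0 → K x x = K y y := by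
    intro x y hx hy hne
    have h := congrArg conj (hK y x hx)
    rw [hKconj, map_mul, map_pow, inner_conj_symm, hKconj, hK x y hy] at h
    exact (mul_left_cancel₀ (pow_ne_zero n hne) h).symm
  have hdiag : ∀ x y, ‖x‖ = 1 → ‖y‖ = 1 → K x x = K y y := by
    intro x y hx hy
    by_cases hxy : ⟪y, x⟫_ℂ = 0
    · have hyx : ⟪x, y⟫_ℂ = 0 := inner_eq_zero_symm.1 hxy
      have hxx : ⟪x, x⟫_ℂ = 1 := by simp [inner_self_eq_norm_sq_to_K, hx]
      have hyy : ⟪y, y⟫_ℂ = 1 := by simp [inner_self_eq_norm_sq_to_K, hy]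
      have hne : x + y ≠ 0 := by
        intro h
        have h' := congrArg (fun z => ⟪x, z⟫_ℂ) h
        simp only [inner_add_right, hxx, hyx, inner_zero_right, add_zero, one_ne_zero] at h'
      have hnorm : (‖x + y‖ : ℂ) ≠ 0 := by exact_mod_cast norm_ne_zero_iff.2 hne
      have hz : ‖((‖x + y‖ : ℂ)⁻¹ • (x + y))‖ = 1 := norm_smul_inv_norm hne
      rw [hdiag_of_inner_ne _ _ hx hz, hdiag_of_inner_ne _ _ hz hy]
      · rw [inner_smul_right, inner_add_right, hxy, hyy, zero_add, mul_one]
        exact inv_ne_zero hnorm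
      · rw [inner_smul_left, inner_add_left, hxx, hxy, add_zero, mul_one]
        exact (map_ne_zero _).2 (inv_ne_zero hnorm)
    · exact hdiag_of_inner_ne x y hx hy hxy
  have hKy : K y y = ((n + m).choose m : ℂ) := by
    have hae : ∀ᵐ z ∂μ, z ∈ Metric.sphere (0 : EuclideanSpace ℂ (Fin (m + 1))) 1 :=
      (mem_ae_iff_prob_eq_one Metric.isClosed_sphere.measurableSet).2 hsphere
    calc K y y = ∫ _, K y y ∂μ := by simp
      _ = ∫ z, K z z ∂μ := integral_congr_ae (hae.mono fun z hz =>
          hdiag y z hy (by simpa using hz))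
      _ = ((n + m).choose m : ℂ) := by
          simp only [K]
          rw [integral_finsetSum _ fun j _ => integrable_eval_mul_conj_eval hsphere _ _]
          simp [horth]
  have hinner : ⟪y, x⟫_ℂ = ∑ i, x i * conj (y i) := by
    simp [PiLp.inner_apply]
  have h := hK x y hy
  rw [hKy, hinner, mul_comm] at h
  exact h
end

section
/- For each integer n ≥ 3, the quantity 1 − log(log((1 − ε²/2)^{−1}))/log(n/2) is nonnegative for all ε ∈ (0, √2·√(1 − 1/n)], and lim_{n→∞} ∫_0^{√2·√(1−1/n)} √(1 − log(log((1 − ε²/2)^{−1}))/log(n/2)) dε = √2. -/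
open MeasureTheory Filter Topology Set

/-- The square of a number in the domain of the entropy integrand stays below `2 (1 - 1 / n)`. -/
lemma sq_half_le_of_le_sqrt_two_mul {n ε : ℝ} (hn : 1 ≤ n) (h0 : 0 < ε)
    (h : ε ≤ √2 * √(1 - 1 / n)) : ε ^ 2 / 2 ≤ 1 - 1 / n := by
  have h1 : 0 ≤ 1 - 1 / n := by
    rw [sub_nonneg, div_le_one (by linarith)]
    exact hn
  have h2 : ε ^ 2 ≤ (√2 * √(1 - 1 / n)) ^ 2 := pow_le_pow_left₀ h0.le h 2
  rw [mul_pow, Real.sq_sqrt (by norm_num), Real.sq_sqrt h1] at h2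
  linarith

lemma log_le_half {x : ℝ} (hx : 0 < x) : Real.log x ≤ x / 2 := by
  have h1 := Real.log_le_sub_one_of_pos (half_pos hx)
  rw [Real.log_div hx.ne' two_ne_zero] at h1
  linarith [Real.log_two_lt_d9]

lemma le_log_inv_one_sub {u : ℝ} (hu : u < 1) : u ≤ Real.log (1 - u)⁻¹ := by
  rw [Real.log_inv]
  linarith [Real.log_le_sub_one_of_pos (sub_pos.2 hu)]

lemma third_le_log_half {x : ℝ} (hx : 3 ≤ x) : 1 / 3 ≤ Real.log (x / 2) := by
  have h := Real.one_sub_inv_le_log_of_pos (show (0 : ℝ) < 3 / 2 by norm_num)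
  have h2 : Real.log (3 / 2) ≤ Real.log (x / 2) :=
    Real.log_le_log (by norm_num) (by linarith)
  norm_num at h
  linarith

lemma entropy_integrand_nonneg {n ε : ℝ} (hn : 3 ≤ n) (h0 : 0 < ε)
    (h : ε ≤ √2 * √(1 - 1 / n)) :
    0 ≤ 1 - Real.log (Real.log (1 - ε ^ 2 / 2)⁻¹) / Real.log (n / 2) := by
  have hu := sq_half_le_of_le_sqrt_two_mul (by linarith) h0 h
  have hn0 : 0 < n := by linarith
  have hinv : 0 < 1 / n := by positivity
  have hupos : 0 < ε ^ 2 / 2 := by positivity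
  have hL : 0 < Real.log (1 - ε ^ 2 / 2)⁻¹ :=
    hupos.trans_le (le_log_inv_one_sub (by linarith))
  have hle : (1 - ε ^ 2 / 2)⁻¹ ≤ n := inv_le_of_inv_le₀ hn0 (by rw [← one_div]; linarith)
  have hlog : Real.log (1 - ε ^ 2 / 2)⁻¹ ≤ n / 2 :=
    (Real.log_le_log (inv_pos.2 (by linarith)) hle).trans (log_le_half hn0)
  have hc := third_le_log_half hn
  rw [sub_nonneg, div_le_one (by linarith)]
  exact Real.log_le_log hL hlog

lemma sqrt_entropy_integrand_le {n ε : ℝ} (hn : 3 ≤ n) (h0 : 0 < ε) (h : ε ^ 2 / 2 < 1) :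
    √(1 - Real.log (Real.log (1 - ε ^ 2 / 2)⁻¹) / Real.log (n / 2)) ≤
      1 + 3 * (Real.log 2 - 2 * Real.log ε) := by
  have hupos : 0 < ε ^ 2 / 2 := by positivity
  have hlogu : Real.log (ε ^ 2 / 2) = 2 * Real.log ε - Real.log 2 := by
    rw [Real.log_div (by positivity) two_ne_zero, Real.log_pow]
    norm_num
  have hneg : Real.log (ε ^ 2 / 2) < 0 := Real.log_neg hupos h
  have hle := Real.log_le_log hupos (le_log_inv_one_sub h)
  have hc := third_le_log_half hn
  have hc0 : 0 < Real.log (n / 2) := by linarith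
  have hdiv : 3 * Real.log (ε ^ 2 / 2) ≤
      Real.log (Real.log (1 - ε ^ 2 / 2)⁻¹) / Real.log (n / 2) := by
    rw [le_div_iff₀ hc0]
    nlinarith
  rw [Real.sqrt_le_left (by linarith)]
  nlinarith


/-- For each `n ≥ 3` the quantity `1 − log(log((1−ε²/2)⁻¹))/log(n/2)` is nonnegative for
`ε ∈ (0, √2√(1−1/n)]`, and
`∫₀^{√2√(1−1/n)} √(1 − log(log((1−ε²/2)⁻¹))/log(n/2)) dε → √2` as `n → ∞`. -/
theorem dudley_integral_limit :
    (∀ n : ℕ, 3 ≤ n → ∀ ε : ℝ, 0 < ε →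
      ε ≤ Real.sqrt 2 * Real.sqrt (1 - 1 / (n : ℝ)) →
      0 ≤ 1 - Real.log (Real.log (1 - ε ^ 2 / 2)⁻¹) / Real.log ((n : ℝ) / 2)) ∧
    Filter.Tendsto
      (fun n : ℕ => ∫ ε in (0 : ℝ)..(Real.sqrt 2 * Real.sqrt (1 - 1 / (n : ℝ))),
        Real.sqrt (1 - Real.log (Real.log (1 - ε ^ 2 / 2)⁻¹) / Real.log ((n : ℝ) / 2)))
      Filter.atTop (nhds (Real.sqrt 2)) := by
  refine ⟨fun n hn ε h0 h => entropy_integrand_nonneg (by exact_mod_cast hn) h0 h, ?_⟩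
  set b : ℕ → ℝ := fun n => √2 * √(1 - 1 / (n : ℝ)) with hb
  set f : ℕ → ℝ → ℝ := fun n ε =>
    √(1 - Real.log (Real.log (1 - ε ^ 2 / 2)⁻¹) / Real.log ((n : ℝ) / 2)) with hf
  have hb_mem (n : ℕ) : b n ∈ Icc 0 (√2) := by
    refine ⟨by positivity, mul_le_of_le_one_right (by positivity) ?_⟩
    rw [Real.sqrt_le_left zero_le_one]
    have : 0 ≤ 1 / (n : ℝ) := by positivity
    linarith
  have hb_lim : Tendsto b atTop (𝓝 (√2)) := by
    have h := ((tendsto_const_nhds (x := (1 : ℝ))).sub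
      tendsto_one_div_atTop_nhds_zero_nat).sqrt.const_mul (√2)
    simpa [hb] using h
  have hlog_lim : Tendsto (fun n : ℕ => Real.log ((n : ℝ) / 2)) atTop atTop :=
    Real.tendsto_log_atTop.comp (tendsto_natCast_atTop_atTop.atTop_div_const two_pos)
  have hne : ∀ᵐ ε : ℝ, ε ≠ √2 := Measure.ae_ne volume _
  have hmain : Tendsto (fun n => ∫ ε in (0 : ℝ)..√2, indicator {x | x ≤ b n} (f n) ε) atTop
      (𝓝 (∫ _ in (0 : ℝ)..√2, (1 : ℝ))) := by
    refine intervalIntegral.tendsto_integral_filter_of_dominated_convergence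
      (fun ε => 1 + 3 * (Real.log 2 - 2 * Real.log ε)) ?_ ?_ ?_ ?_
    · refine Eventually.of_forall fun n => Measurable.aestronglyMeasurable ?_
      refine Measurable.indicator ?_ measurableSet_Iic
      simp only [hf]
      fun_prop
    · filter_upwards [eventually_ge_atTop 3] with n hn
      filter_upwards [hne] with ε hε hmem
      rw [uIoc_of_le (by positivity)] at hmem
      have hlt : ε < √2 := lt_of_le_of_ne hmem.2 hε
      have hsq : ε ^ 2 / 2 < 1 := by
        have := (Real.lt_sqrt hmem.1.le).1 hlt
        linarith
      refine (norm_indicator_le_norm_self _ _).trans ?_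
      rw [Real.norm_of_nonneg (Real.sqrt_nonneg _)]
      exact sqrt_entropy_integrand_le (by exact_mod_cast hn) hmem.1 hsq
    · exact intervalIntegrable_const.add ((intervalIntegrable_const.sub
        (intervalIntegral.intervalIntegrable_log'.const_mul 2)).const_mul 3)
    · filter_upwards [hne] with ε hε hmem
      rw [uIoc_of_le (by positivity)] at hmem
      have hlt : ε < √2 := lt_of_le_of_ne hmem.2 hε
      have hlim : Tendsto (fun n => f n ε) atTop (𝓝 1) := by
        have h := ((tendsto_const_nhds (x := (1 : ℝ))).sub
          (hlog_lim.const_div_atTop (Real.log (Real.log (1 - ε ^ 2 / 2)⁻¹)))).sqrt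
        simpa [hf] using h
      refine hlim.congr' ?_
      filter_upwards [hb_lim.eventually (eventually_ge_nhds hlt)] with n hn
      exact (indicator_of_mem (s := {x | x ≤ b n}) hn (f n)).symm
  simp only [intervalIntegral.integral_indicator (hb_mem _)] at hmain
  simpa [hb, hf] using hmain
end
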